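/- arXiv:1901.02728 — 3 statements merged into one kernel-verified Lean document; each statement's English description precedes it below -/
import Mathlib

section
/- Suppose (u,v) is a smooth classical solution of the system S_{λ,μ} with f ≡ g ≡ 1 and 0 < μ ≤ λ. Then (μ/λ)·u(x) ≤ v(x) ≤ u(x) for almost every x ∈ Ω. -/
open MeasureTheory Metric Set Filter Topology

noncomputable section

/-- Euclidean space `ℝ^N`. -/
abbrev Euc (N : ℕ) := EuclideanSpace ℝ (Fin N)

/-- Second derivative of `u` at `x` in the `i`-th coordinate direction. -/
noncomputable def secondDerivCoord {N : ℕ} (u : Euc N → ℝ) (i : Fin N) (x : Euc N) : ℝ :=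
  deriv (fun t : ℝ => fderiv ℝ u (x + t • (EuclideanSpace.single i (1:ℝ)))
    (EuclideanSpace.single i (1:ℝ))) 0

/-- The Laplacian `Δu = ∑ ∂²u/∂xᵢ²`. -/
noncomputable def lap {N : ℕ} (u : Euc N → ℝ) (x : Euc N) : ℝ :=
  ∑ i : Fin N, secondDerivCoord u i x

/-- A (smooth) bounded domain: open, bounded and nonempty. -/
def IsBddDomain {N : ℕ} (Ω : Set (Euc N)) : Prop :=
  IsOpen Ω ∧ Bornology.IsBounded Ω ∧ Ω.Nonempty

/-- Hypothesis (H): `f ∈ C^α(Ω̄)` for some `α ∈ (0,1]`, `0 ≤ f ≤ 1`, and `f > 0`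
on a subset of `Ω` of positive measure. -/
def HypH {N : ℕ} (Ω : Set (Euc N)) (f : Euc N → ℝ) : Prop :=
  (∃ α : NNReal, 0 < α ∧ α ≤ 1 ∧ ∃ C : NNReal, HolderOnWith C α f (closure Ω)) ∧
  (∀ x ∈ closure Ω, 0 ≤ f x ∧ f x ≤ 1) ∧
  0 < volume {x ∈ Ω | 0 < f x}

/-- A classical solution `(u,v)` of the system `S_{λ,μ}` on `Ω`:
`u, v ∈ C²(Ω) ∩ C(Ω̄)`, `0 ≤ u, v < 1` in `Ω`, `u = v = 0` on `∂Ω`,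
`-Δu = λ f(x)/(1-v)²` and `-Δv = μ g(x)/(1-u)²` in `Ω`. -/
structure IsClassicalSolution {N : ℕ} (Ω : Set (Euc N)) (f g : Euc N → ℝ)
    (lam mu : ℝ) (u v : Euc N → ℝ) : Prop where
  smooth_u : ContDiffOn ℝ 2 u Ω
  smooth_v : ContDiffOn ℝ 2 v Ω
  cont_u : ContinuousOn u (closure Ω)
  cont_v : ContinuousOn v (closure Ω)
  range_u : ∀ x ∈ Ω, 0 ≤ u x ∧ u x < 1
  range_v : ∀ x ∈ Ω, 0 ≤ v x ∧ v x < 1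
  bdry_u : ∀ x ∈ frontier Ω, u x = 0
  bdry_v : ∀ x ∈ frontier Ω, v x = 0
  eq_u : ∀ x ∈ Ω, -lap u x = lam * f x / (1 - v x) ^ 2
  eq_v : ∀ x ∈ Ω, -lap v x = mu * g x / (1 - u x) ^ 2

/-- A minimal solution: a classical solution lying below every classical solution. -/
def IsMinimalSolution {N : ℕ} (Ω : Set (Euc N)) (f g : Euc N → ℝ)
    (lam mu : ℝ) (u v : Euc N → ℝ) : Prop :=
  IsClassicalSolution Ω f g lam mu u v ∧
  ∀ U V : Euc N → ℝ, IsClassicalSolution Ω f g lam mu U V →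
    ∀ x ∈ Ω, u x ≤ U x ∧ v x ≤ V x

/-- The existence region `Λ`: parameter pairs in the positive quadrant for which
the system has a classical solution. -/
def LambdaSet {N : ℕ} (Ω : Set (Euc N)) (f g : Euc N → ℝ) : Set (ℝ × ℝ) :=
  {p | 0 < p.1 ∧ 0 < p.2 ∧ ∃ u v, IsClassicalSolution Ω f g p.1 p.2 u v}

theorem aux_line_diff {N : ℕ} (u : Euc N → ℝ) (x e : Euc N) (hu : ContDiffAt ℝ 2 u x) :
    DifferentiableAt ℝ (fun t : ℝ => fderiv ℝ u (x + t • e) e) 0 := by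
  have h1 : ContDiffAt ℝ 1 (fderiv ℝ u) x := hu.fderiv_right (by norm_num)
  have h2 : DifferentiableAt ℝ (fderiv ℝ u) (x + (0:ℝ) • e) := by
    simpa using h1.differentiableAt (by norm_num)
  have h3 : DifferentiableAt ℝ (fun t : ℝ => x + t • e) 0 := by fun_prop
  have h4 : DifferentiableAt ℝ (fun t : ℝ => fderiv ℝ u (x + t • e)) 0 :=
    DifferentiableAt.comp (0:ℝ) (g := fderiv ℝ u) h2 h3
  exact h4.clm_apply (differentiableAt_const e)

theorem aux_line_tendsto {N : ℕ} (x e : Euc N) :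
    Tendsto (fun t : ℝ => x + t • e) (𝓝 0) (𝓝 x) := by
  have h3 : Continuous (fun t : ℝ => x + t • e) := by fun_prop
  simpa using h3.tendsto 0

theorem aux_ev_diff {N : ℕ} (u : Euc N → ℝ) (x : Euc N) (hu : ContDiffAt ℝ 2 u x) :
    ∀ᶠ y in 𝓝 x, DifferentiableAt ℝ u y := by
  filter_upwards [hu.eventually (by simp)] with y hy
  exact hy.differentiableAt (by norm_num)

theorem aux_lin {N : ℕ} (u v : Euc N → ℝ) (x : Euc N) (a b : ℝ)
    (hu : ContDiffAt ℝ 2 u x) (hv : ContDiffAt ℝ 2 v x) :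
    lap (fun y => a * u y + b * v y) x = a * lap u x + b * lap v x := by
  unfold lap
  rw [Finset.mul_sum, Finset.mul_sum, ← Finset.sum_add_distrib]
  refine Finset.sum_congr rfl fun i _ => ?_
  unfold secondDerivCoord
  set e : Euc N := EuclideanSpace.single i (1:ℝ)
  have hev : (fun t : ℝ => fderiv ℝ (fun y => a * u y + b * v y) (x + t • e) e) =ᶠ[𝓝 0]
      fun t => a * fderiv ℝ u (x + t • e) e + b * fderiv ℝ v (x + t • e) e := by
    filter_upwards [(aux_line_tendsto x e).eventually (aux_ev_diff u x hu),
      (aux_line_tendsto x e).eventually (aux_ev_diff v x hv)] with t h1 h2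
    have := ((h1.hasFDerivAt.const_mul a).add (h2.hasFDerivAt.const_mul b)).fderiv
    erw [this]
    simp
  rw [hev.deriv_eq]
  have d1 := (aux_line_diff u x e hu).hasDerivAt
  have d2 := (aux_line_diff v x e hv).hasDerivAt
  exact ((d1.const_mul a).add (d2.const_mul b)).deriv

theorem aux_min {N : ℕ} (w : Euc N → ℝ) (x : Euc N)
    (hw : ContDiffAt ℝ 2 w x) (hm : IsLocalMin w x) : 0 ≤ lap w x := by
  refine Finset.sum_nonneg fun i _ => ?_
  unfold secondDerivCoord
  set e : Euc N := EuclideanSpace.single i (1:ℝ)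
  by_contra hneg
  push Not at hneg
  set φ : ℝ → ℝ := fun t => w (x + t • e) with hφ
  have hT := aux_line_tendsto x e
  have hd : deriv φ =ᶠ[𝓝 0] fun t => fderiv ℝ w (x + t • e) e := by
    filter_upwards [hT.eventually (aux_ev_diff w x hw)] with t h1
    have h3 : HasDerivAt (fun t : ℝ => x + t • e) e t := by
      simpa using ((hasDerivAt_id t).smul_const e).const_add x
    exact (h1.hasFDerivAt.comp_hasDerivAt t h3).deriv
  have hmin : IsLocalMin φ 0 := by
    have := hT.eventually hm
    filter_upwards [this] with t ht
    simpa [hφ] using ht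
  have hdd : deriv (deriv φ) 0 < 0 := by rw [hd.deriv_eq]; exact hneg
  have hc : ContinuousAt φ 0 := by
    have h2 : ContinuousAt w (x + (0:ℝ) • e) := by simpa using hw.continuousAt
    have h3 : ContinuousAt (fun t : ℝ => x + t • e) 0 := by fun_prop
    exact ContinuousAt.comp (g := w) h2 h3
  have hmax : IsLocalMax φ 0 :=
    isLocalMax_of_deriv_deriv_neg hdd hmin.deriv_eq_zero hc
  have hconst : φ =ᶠ[𝓝 0] fun _ => φ 0 := by
    filter_upwards [hmin, hmax] with t h1 h2
    exact le_antisymm h2 h1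
  have := hconst.deriv.deriv_eq
  simp at this
  linarith

theorem aux_cmp {N : ℕ} (Ω : Set (Euc N)) (hΩ : IsBddDomain Ω) (lam mu : ℝ)
    (u v : Euc N → ℝ)
    (hsol : IsClassicalSolution Ω (fun _ => (1:ℝ)) (fun _ => (1:ℝ)) lam mu u v)
    (a b : ℝ)
    (h : ∀ x ∈ Ω, a * u x + b * v x < 0 →
      0 < a * (lam / (1 - v x) ^ 2) + b * (mu / (1 - u x) ^ 2)) :
    ∀ x ∈ Ω, 0 ≤ a * u x + b * v x := by
  obtain ⟨ho, hb, hne⟩ := hΩ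
  have hK : IsCompact (closure Ω) := hb.isCompact_closure
  have hc : ContinuousOn (fun y => a * u y + b * v y) (closure Ω) :=
    (hsol.cont_u.const_mul a).add (hsol.cont_v.const_mul b)
  obtain ⟨x0, hx0, hmin⟩ := hK.exists_isMinOn hne.closure hc
  intro x hx
  by_contra hneg
  push Not at hneg
  have hx0neg : a * u x0 + b * v x0 < 0 := lt_of_le_of_lt (hmin (subset_closure hx)) hneg
  have hx0Ω : x0 ∈ Ω := by
    by_contra hn
    have hf : x0 ∈ frontier Ω := ⟨hx0, by rwa [ho.interior_eq]⟩
    rw [hsol.bdry_u x0 hf, hsol.bdry_v x0 hf] at hx0neg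
    simp at hx0neg
  have hnh := ho.mem_nhds hx0Ω
  have cu := hsol.smooth_u.contDiffAt hnh
  have cv := hsol.smooth_v.contDiffAt hnh
  have hl := aux_min (fun y => a * u y + b * v y) x0
    ((contDiffAt_const.mul cu).add (contDiffAt_const.mul cv))
    (hmin.isLocalMin (mem_of_superset hnh subset_closure))
  rw [aux_lin u v x0 a b cu cv] at hl
  have e1 := hsol.eq_u x0 hx0Ω
  have e2 := hsol.eq_v x0 hx0Ω
  have := h x0 hx0Ω hx0neg
  simp only [mul_one] at e1 e2
  rw [← e1, ← e2] at this
  linarith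

/-- **Lemma (ordering of the components).** If `(u,v)` is a smooth solution of `S_{λ,μ}`
with `f ≡ g ≡ 1` and `0 < μ ≤ λ`, then `(μ/λ)u ≤ v ≤ u` a.e. in `Ω`. -/
theorem statement7 {N : ℕ} (hN : 2 ≤ N) (Ω : Set (Euc N)) (hΩ : IsBddDomain Ω)
    (lam mu : ℝ) (hmu : 0 < mu) (hml : mu ≤ lam)
    (u v : Euc N → ℝ)
    (hsol : IsClassicalSolution Ω (fun _ => (1:ℝ)) (fun _ => (1:ℝ)) lam mu u v) :
    ∀ᵐ x ∂(volume.restrict Ω), (mu / lam) * u x ≤ v x ∧ v x ≤ u x := by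
  have hlam : 0 < lam := lt_of_lt_of_le hmu hml
  have hvu : ∀ x ∈ Ω, v x ≤ u x := by
    have := aux_cmp Ω hΩ lam mu u v hsol 1 (-1) (by
      intro x hx hlt
      have h1 := (hsol.range_u x hx).2
      have h2 := (hsol.range_v x hx).2
      have h3 : mu / (1 - u x) ^ 2 < mu / (1 - v x) ^ 2 := by
        apply div_lt_div_of_pos_left hmu (by nlinarith)
        nlinarith
      have h4 : mu / (1 - v x) ^ 2 ≤ lam / (1 - v x) ^ 2 := by gcongr
      linarith)
    intro x hx
    linarith [this x hx]
  have hε : ∀ ε > 0, ∀ x ∈ Ω, 0 ≤ -(mu / lam) * u x + (1 + ε) * v x := by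
    intro ε hε
    refine aux_cmp Ω hΩ lam mu u v hsol (-(mu / lam)) (1 + ε) ?_
    intro x hx _
    have h1 := (hsol.range_u x hx).2
    have h2 := (hsol.range_v x hx).2
    have h0 := hvu x hx
    have h3 : mu / (1 - v x) ^ 2 ≤ mu / (1 - u x) ^ 2 := by
      apply div_le_div_of_nonneg_left hmu.le (by nlinarith)
      nlinarith
    have h5 : 0 < mu / (1 - u x) ^ 2 := div_pos hmu (by nlinarith)
    have h6 : -(mu / lam) * (lam / (1 - v x) ^ 2) = -(mu / (1 - v x) ^ 2) := by
      field_simp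
    rw [h6]
    nlinarith
  filter_upwards [ae_restrict_mem hΩ.1.measurableSet] with x hx
  refine ⟨le_of_forall_pos_le_add fun ε hp => ?_, hvu x hx⟩
  have h1 := hε ε hp x hx
  have h2 := (hsol.range_v x hx).2
  nlinarith
end
end

section
/- Suppose f and g satisfy hypothesis (H) on a smooth bounded domain Ω ⊂ ℝ^N (N ≥ 2). Then the set Λ of parameter pairs (λ,μ) in the positive quadrant for which the system S_{λ,μ} has a classical solution is bounded. -/
open MeasureTheory Metric Set Filter Topology

noncomputable section

lemma second_deriv_nonneg_aux {p : ℝ → ℝ} {L : ℝ} {q : ℝ → ℝ}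
    (hp : ∀ᶠ t in 𝓝 (0:ℝ), HasDerivAt p (q t) t) (hq : HasDerivAt q L 0)
    (hmin : IsLocalMin p 0) : 0 ≤ L := by
  by_contra hL
  push Not at hL
  have hdq : deriv p =ᶠ[𝓝 0] q := hp.mono fun t ht => ht.deriv
  have h2 : deriv (deriv p) 0 = L := by rw [hdq.deriv_eq, hq.deriv]
  have hd0 : deriv p 0 = 0 := hmin.deriv_eq_zero
  have hmax : IsLocalMax p 0 :=
    isLocalMax_of_deriv_deriv_neg (by rw [h2]; exact hL) hd0 hp.self_of_nhds.continuousAt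
  have hc : p =ᶠ[𝓝 0] fun _ => p 0 := by
    filter_upwards [hmin, hmax] with t h1 h2 using le_antisymm h2 h1
  have h3 : deriv p =ᶠ[𝓝 0] deriv (fun _ => p 0) := hc.deriv
  have h4 := h3.deriv_eq
  rw [h2] at h4
  simp at h4
  linarith

lemma second_coord_ge {N : ℕ} {Ω : Set (Euc N)} (hΩ : IsOpen Ω) {u : Euc N → ℝ}
    (hu : ContDiffOn ℝ 2 u Ω) (x₀ y : Euc N) (hy : y ∈ Ω) (k : ℝ)
    (hmin : IsLocalMin (fun x => u x + k * ‖x - x₀‖ ^ 2) y) (i : Fin N) :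
    -(2 * k) ≤ secondDerivCoord u i y := by
  set e : Euc N := EuclideanSpace.single i (1:ℝ) with he
  have hen : ‖e‖ = 1 := by simp [he]
  have hline : ∀ t : ℝ, HasDerivAt (fun t : ℝ => y + t • e) e t := by
    intro t
    simpa using ((hasDerivAt_id t).smul_const e).const_add y
  have hlc : ContinuousAt (fun t : ℝ => y + t • e) 0 := (hline 0).continuousAt
  have hl0 : y + (0:ℝ) • e = y := by simp
  have hev : ∀ᶠ t in 𝓝 (0:ℝ), y + t • e ∈ Ω :=
    hlc.eventually (by simpa using hΩ.mem_nhds hy)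
  have hexp : ∀ t : ℝ, ‖y + t • e - x₀‖ ^ 2
      = ‖y - x₀‖ ^ 2 + 2 * t * inner ℝ (y - x₀) e + t ^ 2 := by
    intro t
    have : y + t • e - x₀ = (y - x₀) + t • e := by abel
    rw [this, norm_add_sq_real, inner_smul_right, norm_smul, hen]
    simp
    ring
  have hfd : DifferentiableAt ℝ (fderiv ℝ u) y :=
    ((hu.contDiffAt (hΩ.mem_nhds hy)).fderiv_right (m := 1) (by norm_num)).differentiableAt
      (by norm_num)
  have hA : HasDerivAt (fun t : ℝ => fderiv ℝ u (y + t • e) e) (secondDerivCoord u i y) 0 := by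
    have h1 : DifferentiableAt ℝ (fun t : ℝ => fderiv ℝ u (y + t • e)) 0 :=
      DifferentiableAt.comp (0:ℝ) (g := fderiv ℝ u) (by rw [hl0]; exact hfd)
        (hline 0).differentiableAt
    have h2 : DifferentiableAt ℝ (fun t : ℝ => fderiv ℝ u (y + t • e) e) 0 :=
      h1.clm_apply (differentiableAt_const e)
    exact h2.hasDerivAt
  have key := second_deriv_nonneg_aux
    (p := fun t => u (y + t • e)
      + k * (‖y - x₀‖ ^ 2 + 2 * t * inner ℝ (y - x₀) e + t ^ 2))
    (q := fun t => fderiv ℝ u (y + t • e) e + k * (2 * inner ℝ (y - x₀) e + 2 * t))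
    (L := secondDerivCoord u i y + k * 2) ?_ ?_ ?_
  · linarith
  · filter_upwards [hev] with t ht
    have hd : DifferentiableAt ℝ u (y + t • e) :=
      (hu.contDiffAt (hΩ.mem_nhds ht)).differentiableAt (by norm_num)
    have h1 : HasDerivAt (fun t : ℝ => u (y + t • e)) (fderiv ℝ u (y + t • e) e) t :=
      hd.hasFDerivAt.comp_hasDerivAt t (hline t)
    refine h1.add (HasDerivAt.const_mul k ?_)
    have h3 : HasDerivAt (fun t : ℝ => ‖y - x₀‖ ^ 2 + 2 * t * inner ℝ (y - x₀) e)
        (2 * inner ℝ (y - x₀) e) t := by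
      have := (((hasDerivAt_id t).const_mul 2).mul_const (inner ℝ (y - x₀) e)).const_add
        (‖y - x₀‖ ^ 2)
      simpa using this
    have h4 : HasDerivAt (fun t : ℝ => t ^ 2) (2 * t) t := by
      simpa using hasDerivAt_pow 2 t
    exact h3.add h4
  · refine hA.add (HasDerivAt.const_mul k ?_)
    have := ((hasDerivAt_id (0:ℝ)).const_mul 2).const_add (2 * inner ℝ (y - x₀) e)
    simpa using this
  · have h5 : IsLocalMin ((fun x => u x + k * ‖x - x₀‖ ^ 2) ∘ fun t : ℝ => y + t • e) 0 := by
      have ht : Tendsto (fun t : ℝ => y + t • e) (𝓝 0) (𝓝 y) := by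
        have := hlc.tendsto
        rwa [hl0] at this
      have := ht.eventually hmin
      filter_upwards [this] with t h
      simpa using h
    simpa only [Function.comp_def, hexp] using h5

lemma lam_le {N : ℕ} {Ω : Set (Euc N)} (hΩ : IsOpen Ω) {f : Euc N → ℝ} {x₀ : Euc N} {r c : ℝ}
    (hr : 0 < r) (hc : 0 < c) (hball : closedBall x₀ r ⊆ Ω) (hfc : ∀ x ∈ closedBall x₀ r, c ≤ f x)
    {lam : ℝ} (hlam : 0 < lam) {u v : Euc N → ℝ} (hu : ContDiffOn ℝ 2 u Ω)
    (hur : ∀ x ∈ Ω, 0 ≤ u x ∧ u x < 1) (hvr : ∀ x ∈ Ω, 0 ≤ v x ∧ v x < 1)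
    (heq : ∀ x ∈ Ω, -lap u x = lam * f x / (1 - v x) ^ 2) :
    lam ≤ N * (2 * (1 / r ^ 2)) / c := by
  set k : ℝ := 1 / r ^ 2 with hk
  have hcont : ContinuousOn (fun x => u x + k * ‖x - x₀‖ ^ 2) (closedBall x₀ r) :=
    (hu.continuousOn.mono hball).add (by fun_prop)
  obtain ⟨y, hyb, hymin⟩ := (isCompact_closedBall x₀ r).exists_isMinOn
    ⟨x₀, mem_closedBall_self hr.le⟩ hcont
  have hy : y ∈ Ω := hball hyb
  have hx : x₀ ∈ closedBall x₀ r := mem_closedBall_self hr.le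
  have hyin : y ∈ ball x₀ r := by
    by_contra hn
    have hd : ‖y - x₀‖ = r := by
      rw [mem_ball, dist_eq_norm, not_lt] at hn
      rw [mem_closedBall, dist_eq_norm] at hyb
      exact le_antisymm hyb hn
    have h1 : u y + k * ‖y - x₀‖ ^ 2 ≤ u x₀ + k * ‖x₀ - x₀‖ ^ 2 := hymin hx
    have h2 : k * r ^ 2 = 1 := by rw [hk]; field_simp
    rw [hd, h2] at h1
    simp at h1
    linarith [(hur y hy).1, (hur x₀ (hball hx)).2]
  have hloc : IsLocalMin (fun x => u x + k * ‖x - x₀‖ ^ 2) y :=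
    hymin.isLocalMin (mem_of_superset (isOpen_ball.mem_nhds hyin) ball_subset_closedBall)
  have hlap : -(N * (2 * k)) ≤ lap u y := by
    have : ∑ i : Fin N, (-(2 * k)) ≤ lap u y :=
      Finset.sum_le_sum fun i _ => second_coord_ge hΩ hu x₀ y hy k hloc i
    simpa using this
  have h1 := heq y hy
  obtain ⟨hv0, hv1⟩ := hvr y hy
  have h2 : lam * f y ≤ lam * f y / (1 - v y) ^ 2 := by
    have hfy := hfc y hyb
    rw [le_div_iff₀ (by nlinarith)]
    have : (1 - v y) ^ 2 ≤ 1 := by nlinarith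
    have h0 : 0 ≤ lam * f y := by nlinarith
    nlinarith
  rw [le_div_iff₀ hc]
  have := hfc y hyb
  nlinarith

lemma good_ball {N : ℕ} {Ω : Set (Euc N)} (hΩ : IsOpen Ω) {f : Euc N → ℝ} (hf : HypH Ω f) :
    ∃ x₀ : Euc N, ∃ r c : ℝ, 0 < r ∧ 0 < c ∧ closedBall x₀ r ⊆ Ω ∧
      ∀ x ∈ closedBall x₀ r, c ≤ f x := by
  obtain ⟨⟨α, hα, -, C, hC⟩, -, hvol⟩ := hf
  obtain ⟨x₀, hx, hfx⟩ := nonempty_of_measure_ne_zero hvol.ne'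
  have hca : ContinuousAt f x₀ :=
    ((hC.continuousOn hα).mono subset_closure).continuousAt (hΩ.mem_nhds hx)
  have hev : ∀ᶠ x in 𝓝 x₀, x ∈ Ω ∧ f x₀ / 2 < f x :=
    (hΩ.eventually_mem hx).and (hca.eventually (lt_mem_nhds (by linarith)))
  obtain ⟨r, hr, hb⟩ := nhds_basis_closedBall.eventually_iff.1 hev
  exact ⟨x₀, r, f x₀ / 2, hr, by linarith, fun x h => (hb h).1, fun x h => (hb h).2.le⟩

/-- **Lemma (Λ is bounded).** The existence region `Λ` is a bounded subset of the
plane. -/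
theorem statement9 {N : ℕ} (hN : 2 ≤ N) (Ω : Set (Euc N)) (hΩ : IsBddDomain Ω)
    (f g : Euc N → ℝ) (hf : HypH Ω f) (hg : HypH Ω g) :
    Bornology.IsBounded (LambdaSet Ω f g) := by
  obtain ⟨x, r, c, hr, hc, hb, hfc⟩ := good_ball hΩ.1 hf
  obtain ⟨x', r', c', hr', hc', hb', hgc⟩ := good_ball hΩ.1 hg
  refine ((Metric.isBounded_Icc (0:ℝ) (N * (2 * (1 / r ^ 2)) / c)).prod
    (Metric.isBounded_Icc (0:ℝ) (N * (2 * (1 / r' ^ 2)) / c'))).subset ?_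
  rintro ⟨l, m⟩ ⟨hl, hm, u, v, h⟩
  exact ⟨⟨hl.le, lam_le hΩ.1 hr hc hb hfc hl h.smooth_u h.range_u h.range_v h.eq_u⟩,
    ⟨hm.le, lam_le hΩ.1 hr' hc' hb' hgc hm h.smooth_v h.range_v h.range_u h.eq_v⟩⟩
end
end

section
/- Suppose f and g satisfy hypothesis (H). If (λ′,μ′) lies in the positive quadrant with λ′ ≤ λ and μ′ ≤ μ for some (λ,μ) ∈ Λ, then (λ′,μ′) ∈ Λ; that is, the existence region Λ is downward closed in each parameter. -/
open MeasureTheory Metric Set Filter Topology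

noncomputable section

/-- Smooth radial kernels `q`, `φ` with `∇q = -y φ`. -/
structure Ker (N : ℕ) where
  q : Euc N → ℝ
  p : Euc N → ℝ
  q_smooth : ContDiff ℝ 3 q
  p_smooth : ContDiff ℝ 3 p
  q_nonneg : ∀ y, 0 ≤ q y
  p_nonneg : ∀ y, 0 ≤ p y
  q_supp : ∀ y, 1 ≤ ‖y‖ → q y = 0
  p_supp : ∀ y, 1 ≤ ‖y‖ → p y = 0
  q_int : 0 < ∫ y, q y
  p_int : ∫ y, p y = 1
  q_deriv : ∀ y v, fderiv ℝ q y v = - (p y * inner ℝ y v)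

lemma hasCompactSupport_of_ball {N : ℕ} {F : Type*} [Zero F] {q : Euc N → F}
    (h : ∀ y, 1 ≤ ‖y‖ → q y = 0) : HasCompactSupport q := by
  refine HasCompactSupport.of_support_subset_isCompact (isCompact_closedBall (0 : Euc N) 1) ?_
  intro y hy
  simp only [mem_closedBall, dist_zero_right]
  by_contra hc
  exact hy (h y (le_of_lt (not_le.1 hc)))

lemma expglue_hasDerivAt (x : ℝ) :
    HasDerivAt expNegInvGlue ((x⁻¹)^2 * expNegInvGlue x) x := by
  have := expNegInvGlue.hasDerivAt_polynomial_eval_inv_mul 1 x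
  simpa using this

lemma exists_ker (N : ℕ) : Nonempty (Ker N) := by
  set q0 : Euc N → ℝ := fun y => expNegInvGlue (1 - ‖y‖^2) with hq0
  set p0 : Euc N → ℝ := fun y => 2 * (((1 - ‖y‖^2)⁻¹)^2 * expNegInvGlue (1 - ‖y‖^2)) with hp0
  have hns : ContDiff ℝ 3 (fun y : Euc N => 1 - ‖y‖^2) := contDiff_const.sub (contDiff_norm_sq ℝ)
  have hqs : ContDiff ℝ 3 q0 := (expNegInvGlue.contDiff (n := 3)).comp hns
  have hps : ContDiff ℝ 3 p0 := by
    have h := (expNegInvGlue.contDiff_polynomial_eval_inv_mul (n := 3) (Polynomial.X^2)).comp hns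
    have := (contDiff_const (c := (2:ℝ))).mul h
    convert! this using 1
    ext y
    simp [hp0]
  have hq0n : ∀ y, 0 ≤ q0 y := fun y => expNegInvGlue.nonneg _
  have hp0n : ∀ y, 0 ≤ p0 y := fun y =>
    mul_nonneg (by norm_num) (mul_nonneg (sq_nonneg _) (expNegInvGlue.nonneg _))
  have hz : ∀ y : Euc N, 1 ≤ ‖y‖ → expNegInvGlue (1 - ‖y‖^2) = 0 := fun y hy =>
    expNegInvGlue.zero_of_nonpos (by nlinarith)
  have hq0s : ∀ y, 1 ≤ ‖y‖ → q0 y = 0 := hz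
  have hp0s : ∀ y, 1 ≤ ‖y‖ → p0 y = 0 := fun y hy => by simp [hp0, hz y hy]
  have hqi : 0 < ∫ y, q0 y := by
    refine hqs.continuous.integral_pos_of_hasCompactSupport_nonneg_nonzero
      (hasCompactSupport_of_ball hq0s) hq0n (x := 0) ?_
    simp only [hq0]
    exact (expNegInvGlue.pos_of_pos (by simp)).ne'
  have hpi : 0 < ∫ y, p0 y := by
    refine hps.continuous.integral_pos_of_hasCompactSupport_nonneg_nonzero
      (hasCompactSupport_of_ball hp0s) hp0n (x := 0) ?_
    simp only [hp0]
    have := (expNegInvGlue.pos_of_pos (x := 1) (by simp)).ne'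
    simp [this]
  set c := (∫ y, p0 y)⁻¹ with hc
  have hcpos : 0 < c := inv_pos.2 hpi
  refine ⟨⟨fun y => c * q0 y, fun y => c * p0 y, contDiff_const.mul hqs, contDiff_const.mul hps,
    fun y => mul_nonneg hcpos.le (hq0n y), fun y => mul_nonneg hcpos.le (hp0n y),
    fun y hy => by simp [hq0s y hy], fun y hy => by simp [hp0s y hy], ?_, ?_, ?_⟩⟩
  · rw [integral_const_mul]; positivity
  · rw [integral_const_mul, hc, inv_mul_cancel₀ hpi.ne']
  · intro y v
    have h1 : HasFDerivAt (fun y : Euc N => 1 - ‖y‖^2) (-(2 • (innerSL ℝ y))) y :=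
      ((hasStrictFDerivAt_norm_sq y).hasFDerivAt).const_sub 1
    have h2 := ((expglue_hasDerivAt (1 - ‖y‖^2)).comp_hasFDerivAt y h1).const_mul c
    have h3 : HasFDerivAt (fun y => c * q0 y) _ y := h2
    rw [h3.fderiv]
    simp [hp0]
    ring


/-- Translation average against a measure. -/
def avg {N : ℕ} (m : Measure (Euc N)) (w : Euc N → ℝ) (x : Euc N) : ℝ := ∫ z, w (x + z) ∂m

namespace Ker
variable {N : ℕ} (k : Ker N)

lemma q_int' : Integrable k.q :=
  k.q_smooth.continuous.integrable_of_hasCompactSupport (hasCompactSupport_of_ball k.q_supp)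
lemma p_int' : Integrable k.p :=
  k.p_smooth.continuous.integrable_of_hasCompactSupport (hasCompactSupport_of_ball k.p_supp)

def pm : Measure (Euc N) := volume.withDensity (fun y => ENNReal.ofReal (k.p y))
def qm : Measure (Euc N) := volume.withDensity (fun y => ENNReal.ofReal (k.q y))
def sm (r : ℝ) : Measure ℝ := (volume.restrict (Ioo 0 r)).withDensity (fun s => ENNReal.ofReal s)

instance : IsFiniteMeasure k.pm := isFiniteMeasure_withDensity_ofReal k.p_int'.2
instance : IsFiniteMeasure k.qm := isFiniteMeasure_withDensity_ofReal k.q_int'.2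
instance (r : ℝ) : IsFiniteMeasure (sm r) := by
  refine isFiniteMeasure_withDensity_ofReal (Integrable.hasFiniteIntegral (f := fun s : ℝ => s) ?_)
  exact (continuous_id.integrableOn_Icc (a := 0) (b := r)).mono_set Ioo_subset_Icc_self

def P (r : ℝ) : Measure (Euc N) := k.pm.map (fun y => r • y)
def K (r : ℝ) : Measure (Euc N) := ((sm r).prod k.qm).map (fun z : ℝ × Euc N => z.1 • z.2)

lemma meas_smul : Measurable (fun z : ℝ × Euc N => z.1 • z.2) := by fun_prop

instance (r : ℝ) : IsFiniteMeasure (k.P r) := by unfold P; infer_instance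
instance (r : ℝ) : IsFiniteMeasure (k.K r) := by unfold K; infer_instance

lemma pm_supp : ∀ᵐ y ∂k.pm, ‖y‖ ≤ 1 := by
  unfold pm
  rw [ae_withDensity_iff (k.p_smooth.continuous.measurable.ennreal_ofReal)]
  refine Eventually.of_forall (fun y hy => ?_)
  by_contra hc
  exact hy (by simp [k.p_supp y (not_le.1 hc).le])

lemma qm_supp : ∀ᵐ y ∂k.qm, ‖y‖ ≤ 1 := by
  unfold qm
  rw [ae_withDensity_iff (k.q_smooth.continuous.measurable.ennreal_ofReal)]
  refine Eventually.of_forall (fun y hy => ?_)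
  by_contra hc
  exact hy (by simp [k.q_supp y (not_le.1 hc).le])

lemma sm_supp (r : ℝ) : ∀ᵐ s ∂(sm r), s ∈ Ioo 0 r := by
  unfold sm
  exact (withDensity_absolutelyContinuous _ _).ae_le (ae_restrict_mem measurableSet_Ioo)

lemma P_supp {r : ℝ} (hr : 0 ≤ r) : ∀ᵐ z ∂(k.P r), ‖z‖ ≤ r := by
  unfold P
  rw [ae_map_iff (by fun_prop) (measurableSet_le measurable_norm measurable_const)]
  filter_upwards [k.pm_supp] with y hy
  rw [norm_smul, Real.norm_of_nonneg hr]
  nlinarith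

lemma K_supp (r : ℝ) : ∀ᵐ z ∂(k.K r), ‖z‖ ≤ r := by
  unfold K
  rw [ae_map_iff meas_smul.aemeasurable (measurableSet_le measurable_norm measurable_const)]
  have h1 := Measure.quasiMeasurePreserving_fst.ae (sm_supp r) (μa := (sm r).prod k.qm)
  have h2 := Measure.quasiMeasurePreserving_snd.ae (k.qm_supp) (μa := (sm r).prod k.qm)
  filter_upwards [h1, h2] with z hz1 hz2
  rw [norm_smul, Real.norm_of_nonneg hz1.1.le]
  have := hz1.1; have := hz1.2
  nlinarith [norm_nonneg z.2]

lemma avg_P {w : Euc N → ℝ} (hw : Measurable w) (r : ℝ) (x : Euc N) :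
    avg (k.P r) w x = ∫ y, k.p y * w (x + r • y) := by
  unfold avg P
  rw [integral_map (by fun_prop)
    (Measurable.aestronglyMeasurable (by fun_prop))]
  unfold pm
  rw [integral_withDensity_eq_integral_toReal_smul
    (k.p_smooth.continuous.measurable.ennreal_ofReal) (by simp)]
  simp [ENNReal.toReal_ofReal (k.p_nonneg _)]

lemma int_qm {w : Euc N → ℝ} : ∫ y, w y ∂k.qm = ∫ y, k.q y * w y := by
  unfold qm
  rw [integral_withDensity_eq_integral_toReal_smul
    (k.q_smooth.continuous.measurable.ennreal_ofReal) (by simp)]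
  simp [ENNReal.toReal_ofReal (k.q_nonneg _)]

lemma int_sm {w : ℝ → ℝ} (r : ℝ) : ∫ s, w s ∂(sm r) = ∫ s in Ioo 0 r, s * w s := by
  unfold sm
  rw [integral_withDensity_eq_integral_toReal_smul
    (Measurable.ennreal_ofReal (f := fun s : ℝ => s) measurable_id) (by simp)]
  refine setIntegral_congr_fun measurableSet_Ioo (fun s hs => ?_)
  simp [ENNReal.toReal_ofReal hs.1.le]

lemma integrable_bdd {α : Type*} [MeasurableSpace α] {m : Measure α} [IsFiniteMeasure m]
    {w : α → ℝ} (hw : Measurable w) {C : ℝ} (hC : ∀ x, |w x| ≤ C) : Integrable w m :=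
  Integrable.of_bound hw.aestronglyMeasurable C (Eventually.of_forall hC)

lemma avg_K {w : Euc N → ℝ} (hw : Measurable w) {C : ℝ} (hC : ∀ x, |w x| ≤ C)
    (r : ℝ) (x : Euc N) :
    avg (k.K r) w x = ∫ s in Ioo 0 r, s * ∫ y, k.q y * w (x + s • y) := by
  unfold avg K
  rw [integral_map meas_smul.aemeasurable
    (Measurable.aestronglyMeasurable (by fun_prop))]
  rw [integral_prod _ (integrable_bdd (by fun_prop) (fun z => hC _)), int_sm]
  simp_rw [int_qm]

instance (r : ℝ) : IsProbabilityMeasure (k.P r) := by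
  have h : avg (k.P r) (fun _ => 1) 0 = 1 := by
    rw [avg_P _ measurable_const]; simp [k.p_int]
  constructor
  unfold avg at h
  simp [Measure.real, ENNReal.toReal_eq_one_iff] at h
  exact h

lemma K_mass {r : ℝ} (hr : 0 < r) : 0 < (k.K r).real univ := by
  have h : avg (k.K r) (fun _ => 1) 0 = (k.K r).real univ := by simp [avg]
  rw [← h, avg_K _ measurable_const (C := 1) (by simp)]
  simp only [mul_one]
  rw [integral_mul_const]
  refine mul_pos ?_ k.q_int
  rw [← integral_Ioc_eq_integral_Ioo, ← intervalIntegral.integral_of_le hr.le, integral_id]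
  have := pow_pos hr 2
  simp only [ne_eq, OfNat.ofNat_ne_zero, not_false_eq_true, zero_pow, sub_zero]
  linarith

end Ker


/-- coordinate vector -/
abbrev ev {N : ℕ} (i : Fin N) : Euc N := EuclideanSpace.single i (1:ℝ)

lemma sd_eq {N : ℕ} {W : Euc N → ℝ} {x : Euc N} (h : ContDiffAt ℝ 2 W x) (i : Fin N) :
    secondDerivCoord W i x = fderiv ℝ (fun z => fderiv ℝ W z (ev i)) x (ev i) := by
  have h1 : ContDiffAt ℝ 1 (fderiv ℝ W) x := h.fderiv_right (by norm_num)
  have h2 : DifferentiableAt ℝ (fun z => fderiv ℝ W z (ev i)) x :=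
    (h1.differentiableAt (by norm_num)).clm_apply (differentiableAt_const _)
  have h3 : HasDerivAt (fun t : ℝ => x + t • ev i) (ev i) 0 := by
    simpa using ((hasDerivAt_id (0:ℝ)).smul_const (ev i)).const_add x
  have h4 : HasFDerivAt (fun z => fderiv ℝ W z (ev i))
      (fderiv ℝ (fun z => fderiv ℝ W z (ev i)) x) (x + (0:ℝ) • ev i) := by
    simpa using h2.hasFDerivAt
  exact (h4.comp_hasDerivAt (0:ℝ) h3).deriv

lemma lap_congr {N : ℕ} {W W' : Euc N → ℝ} {x : Euc N} (h : W =ᶠ[𝓝 x] W') :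
    lap W x = lap W' x := by
  unfold lap
  refine Finset.sum_congr rfl (fun i _ => ?_)
  unfold secondDerivCoord
  apply Filter.EventuallyEq.deriv_eq
  have hc : Tendsto (fun t : ℝ => x + t • ev i) (𝓝 0) (𝓝 x) := by
    have : Continuous (fun t : ℝ => x + t • ev i) := by fun_prop
    simpa using this.tendsto 0
  filter_upwards [hc.eventually (h.fderiv (𝕜 := ℝ))] with t ht
  rw [ht]

lemma lap_continuous {N : ℕ} {W : Euc N → ℝ} (h : ContDiff ℝ 2 W) : Continuous (lap W) := by
  unfold lap
  refine continuous_finsetSum _ (fun i _ => ?_)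
  have e : secondDerivCoord W i
      = fun x => fderiv ℝ (fun z => fderiv ℝ W z (ev i)) x (ev i) := by
    ext x; exact sd_eq h.contDiffAt i
  rw [e]
  have h1 : ContDiff ℝ 1 (fderiv ℝ W) := h.fderiv_right (by norm_num)
  have h2 : ContDiff ℝ 1 (fun z => fderiv ℝ W z (ev i)) := h1.clm_apply contDiff_const
  exact (h2.continuous_fderiv (by norm_num)).clm_apply continuous_const

lemma sum_ev {N : ℕ} (y : Euc N) : ∑ i, y i • ev i = y := by
  ext j
  simp [Finset.sum_apply, Pi.single_apply]

namespace Ker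
variable {N : ℕ} (k : Ker N)

lemma ibp {W : Euc N → ℝ} (h : ContDiff ℝ 2 W) (s : ℝ) (x : Euc N) :
    s * ∫ y, k.q y * lap W (x + s • y) = ∫ y, k.p y * fderiv ℝ W (x + s • y) y := by
  have hqc := hasCompactSupport_of_ball k.q_supp
  have hpc := hasCompactSupport_of_ball k.p_supp
  have h1 : ContDiff ℝ 1 (fderiv ℝ W) := h.fderiv_right (by norm_num)
  have hG : ∀ i, ContDiff ℝ 1 (fun z => fderiv ℝ W z (ev i)) := fun i => h1.clm_apply contDiff_const
  have haff : ContDiff ℝ 1 (fun y : Euc N => x + s • y) := by fun_prop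
  have hG2 : ∀ i, ContDiff ℝ 1 (fun y => fderiv ℝ W (x + s • y) (ev i)) :=
    fun i => (hG i).comp haff
  have hsd : ∀ i, Continuous (fun y => secondDerivCoord W i y) := by
    intro i
    have e : (fun x => secondDerivCoord W i x)
        = fun x => fderiv ℝ (fun z => fderiv ℝ W z (ev i)) x (ev i) := by
      ext x; exact sd_eq h.contDiffAt i
    rw [e]
    exact ((hG i).continuous_fderiv (by norm_num)).clm_apply continuous_const
  have hd : ∀ i y, fderiv ℝ (fun y => fderiv ℝ W (x + s • y) (ev i)) y (ev i)
      = s * secondDerivCoord W i (x + s • y) := by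
    intro i y
    rw [sd_eq h.contDiffAt i]
    have ha : HasFDerivAt (fun y : Euc N => x + s • y) (s • ContinuousLinearMap.id ℝ (Euc N)) y :=
      ((hasFDerivAt_id y).const_smul s).const_add x
    have hb := (((hG i).differentiable (by norm_num)) (x + s • y)).hasFDerivAt
    have hc := hb.comp y ha
    have hc' : HasFDerivAt (fun y => fderiv ℝ W (x + s • y) (ev i)) _ y := hc
    rw [hc'.fderiv]
    simp
  have hi : ∀ i, s * ∫ y, k.q y * secondDerivCoord W i (x + s • y)
      = ∫ y, k.p y * (y i * fderiv ℝ W (x + s • y) (ev i)) := by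
    intro i
    have hdc : Continuous (fun y => fderiv ℝ k.q y (ev i)) :=
      (k.q_smooth.continuous_fderiv (by norm_num)).clm_apply continuous_const
    have key := integral_mul_fderiv_eq_neg_fderiv_mul_of_integrable (μ := (volume : Measure (Euc N)))
      (f := k.q) (g := fun y => fderiv ℝ W (x + s • y) (ev i)) (v := ev i)
      ?_ ?_ ?_ (fun y _ => k.q_smooth.differentiable (by norm_num) y)
      (fun y _ => (hG2 i).differentiable (by norm_num) y)
    · simp_rw [hd] at key
      rw [← integral_const_mul]
      rw [← integral_neg] at key
      refine Eq.trans (integral_congr_ae (Eventually.of_forall fun y => ?_))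
        (key.trans (integral_congr_ae (Eventually.of_forall fun y => ?_)))
      · simp only []; ring
      · simp only []
        rw [k.q_deriv, EuclideanSpace.inner_single_right]
        simp; ring
    · refine (hdc.mul (hG2 i).continuous).integrable_of_hasCompactSupport (HasCompactSupport.mul_right ?_)
      exact hqc.fderiv_apply ℝ (ev i)
    · simp_rw [hd]
      have := hsd i
      exact Continuous.integrable_of_hasCompactSupport
        (k.q_smooth.continuous.mul (by fun_prop)) hqc.mul_right
    · exact (k.q_smooth.continuous.mul (hG2 i).continuous).integrable_of_hasCompactSupport
        hqc.mul_right
  unfold lap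
  simp_rw [Finset.mul_sum]
  rw [integral_finsetSum, Finset.mul_sum]
  · simp_rw [hi]
    rw [← integral_finsetSum]
    · congr 1; ext y
      rw [← Finset.mul_sum]
      congr 1
      conv_rhs => rw [← sum_ev y]
      rw [map_sum]
      simp [sum_ev]
    · intro i _
      have := (hG2 i).continuous
      exact Continuous.integrable_of_hasCompactSupport
        (k.p_smooth.continuous.mul (by fun_prop)) hpc.mul_right
  · intro i _
    have := hsd i
    exact Continuous.integrable_of_hasCompactSupport
        (k.q_smooth.continuous.mul (by fun_prop)) hqc.mul_right

lemma lap_bdd {W : Euc N → ℝ} (h : ContDiff ℝ 2 W) (hc : HasCompactSupport W) :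
    ∃ C, ∀ x, |lap W x| ≤ C := by
  have : HasCompactSupport (lap W) := by
    refine hc.mono' ?_
    intro x hx
    by_contra hn
    apply hx
    have h0 : W =ᶠ[𝓝 x] (fun _ => (0:ℝ)) := notMem_tsupport_iff_eventuallyEq.1 hn
    rw [lap_congr h0]
    simp [lap, secondDerivCoord]
  exact (lap_continuous h).bounded_above_of_compact_support this

theorem c2_id {W : Euc N → ℝ} (h : ContDiff ℝ 2 W) (hc : HasCompactSupport W) {r : ℝ}
    (hr : 0 < r) (x : Euc N) :
    avg (k.P r) W x = W x + avg (k.K r) (lap W) x := by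
  obtain ⟨C, hC⟩ := lap_bdd h hc
  rw [k.avg_P h.continuous.measurable, k.avg_K (lap_continuous h).measurable hC]
  simp_rw [k.ibp h]
  have hfc : Continuous (fderiv ℝ W) := h.continuous_fderiv (by norm_num)
  obtain ⟨D, hD⟩ := hfc.bounded_above_of_compact_support (hc.fderiv ℝ)
  have hftc : ∀ y : Euc N, W (x + r • y) - W x = ∫ s in Ioo 0 r, fderiv ℝ W (x + s • y) y := by
    intro y
    have hder : ∀ s : ℝ, HasDerivAt (fun s : ℝ => W (x + s • y)) (fderiv ℝ W (x + s • y) y) s := by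
      intro s
      have h3 : HasDerivAt (fun t : ℝ => x + t • y) y s := by
        simpa using ((hasDerivAt_id s).smul_const y).const_add x
      exact ((h.differentiable (by norm_num)) (x + s • y)).hasFDerivAt.comp_hasDerivAt s h3
    have := intervalIntegral.integral_eq_sub_of_hasDerivAt (a := 0) (b := r)
      (fun s _ => hder s) (Continuous.intervalIntegrable (by fun_prop) _ _)
    rw [← integral_Ioc_eq_integral_Ioo, ← intervalIntegral.integral_of_le hr.le, this]
    simp
  have hswap : ∫ s in Ioo 0 r, ∫ y, k.p y * fderiv ℝ W (x + s • y) y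
      = ∫ y, ∫ s in Ioo 0 r, k.p y * fderiv ℝ W (x + s • y) y := by
    apply integral_integral_swap
    have hint : Integrable (fun z : ℝ × Euc N => k.p z.2 * D)
        ((volume.restrict (Ioo 0 r)).prod volume) := (k.p_int'.mul_const D).comp_snd _
    refine hint.mono' (Continuous.aestronglyMeasurable ?_) (Eventually.of_forall fun z => ?_)
    · have := k.p_smooth.continuous
      simp only [Function.uncurry_def]
      fun_prop
    · simp only [Function.uncurry_def, norm_mul, Real.norm_of_nonneg (k.p_nonneg z.2)]
      by_cases hz : 1 ≤ ‖z.2‖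
      · simp [k.p_supp _ hz]
      · refine mul_le_mul_of_nonneg_left ?_ (k.p_nonneg _)
        refine (ContinuousLinearMap.le_opNorm _ _).trans ?_
        have := hD (x + z.1 • z.2)
        nlinarith [norm_nonneg (fderiv ℝ W (x + z.1 • z.2)), norm_nonneg z.2]
  rw [hswap]
  simp_rw [integral_const_mul, ← hftc]
  obtain ⟨M, hM⟩ := h.continuous.bounded_above_of_compact_support hc
  simp_rw [mul_sub]
  rw [integral_sub, integral_mul_const, k.p_int]
  · ring
  · have := h.continuous
    exact Continuous.integrable_of_hasCompactSupport
        (k.p_smooth.continuous.mul (by fun_prop)) (hasCompactSupport_of_ball k.p_supp).mul_right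
  · exact k.p_int'.mul_const _

end Ker


section avglemmas
variable {N : ℕ} {m m' : Measure (Euc N)} [IsFiniteMeasure m] [IsFiniteMeasure m']

lemma avg_int {w : Euc N → ℝ} (hw : Measurable w) {C : ℝ} (hC : ∀ x, |w x| ≤ C) (x : Euc N) :
    Integrable (fun z => w (x + z)) m :=
  Ker.integrable_bdd (by fun_prop) (fun z => hC _)

lemma avg_add {w v : Euc N → ℝ} (hw : Measurable w) {C : ℝ} (hC : ∀ x, |w x| ≤ C)
    (hv : Measurable v) {D : ℝ} (hD : ∀ x, |v x| ≤ D) (x : Euc N) :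
    avg m (fun y => w y + v y) x = avg m w x + avg m v x :=
  integral_add (avg_int hw hC x) (avg_int hv hD x)

lemma avg_sub {w v : Euc N → ℝ} (hw : Measurable w) {C : ℝ} (hC : ∀ x, |w x| ≤ C)
    (hv : Measurable v) {D : ℝ} (hD : ∀ x, |v x| ≤ D) (x : Euc N) :
    avg m (fun y => w y - v y) x = avg m w x - avg m v x :=
  integral_sub (avg_int hw hC x) (avg_int hv hD x)

lemma avg_nonneg {w : Euc N → ℝ} (hw : ∀ x, 0 ≤ w x) (x : Euc N) : 0 ≤ avg m w x :=
  integral_nonneg (fun _ => hw _)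

lemma avg_abs_le {w : Euc N → ℝ} {C : ℝ} (hC : ∀ x, |w x| ≤ C) (x : Euc N) :
    |avg m w x| ≤ C * m.real univ := by
  have := norm_integral_le_of_norm_le_const (μ := m) (f := fun z => w (x + z)) (C := C)
    (Eventually.of_forall fun z => hC _)
  exact this

lemma avg_continuous {w : Euc N → ℝ} (hw : Continuous w) {C : ℝ} (hC : ∀ x, |w x| ≤ C) :
    Continuous (avg m w) := by
  unfold avg
  refine continuous_of_dominated (bound := fun _ => C) (fun x => ?_) (fun x => ?_) ?_ ?_
  · exact Continuous.aestronglyMeasurable (by fun_prop)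
  · exact Eventually.of_forall fun z => hC _
  · exact integrable_const _
  · exact Eventually.of_forall fun z => by fun_prop

lemma avg_comm {w : Euc N → ℝ} (hw : Continuous w) {C : ℝ} (hC : ∀ x, |w x| ≤ C) (x : Euc N) :
    avg m (avg m' w) x = avg m' (avg m w) x := by
  unfold avg
  rw [integral_integral_swap]
  · simp_rw [add_right_comm x]
  · refine Ker.integrable_bdd ?_ (C := C) (fun z => hC _)
    simp only [Function.uncurry_def]
    exact Continuous.measurable (by fun_prop)

lemma avg_congr {w v : Euc N → ℝ} {x : Euc N} {r : ℝ} (hm : ∀ᵐ z ∂m, ‖z‖ ≤ r)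
    (h : ∀ y ∈ closedBall x r, w y = v y) : avg m w x = avg m v x := by
  refine integral_congr_ae ?_
  filter_upwards [hm] with z hz
  exact h _ (by simpa [mem_closedBall, dist_eq_norm] using hz)

end avglemmas

namespace Ker
variable {N : ℕ} (k : Ker N)

lemma comm_smooth {w : Euc N → ℝ} (h : ContDiff ℝ 2 w) (hc : HasCompactSupport w) {r t : ℝ}
    (hr : 0 < r) (ht : 0 < t) (x : Euc N) :
    avg (k.P t) (avg (k.K r) w) x + avg (k.K t) w x
      = avg (k.K t) (avg (k.P r) w) x + avg (k.K r) w x := by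
  obtain ⟨C, hC⟩ := h.continuous.bounded_above_of_compact_support hc
  obtain ⟨D, hD⟩ := lap_bdd h hc
  have hL := lap_continuous h
  have e : ∀ r, 0 < r → avg (k.P r) w = fun y => w y + avg (k.K r) (lap w) y := fun r hr => by
    ext y; exact k.c2_id h hc hr y
  rw [avg_comm h.continuous hC, e t ht, e r hr,
    avg_add h.continuous.measurable hC (avg_continuous hL hD).measurable (avg_abs_le hD),
    avg_add h.continuous.measurable hC (avg_continuous hL hD).measurable (avg_abs_le hD),
    avg_comm hL hD (m := k.K r)]
  ring

lemma comm_cont {w : Euc N → ℝ} (h : Continuous w) (hc : HasCompactSupport w) {r t : ℝ}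
    (hr : 0 < r) (ht : 0 < t) (x : Euc N) :
    avg (k.P t) (avg (k.K r) w) x + avg (k.K t) w x
      = avg (k.K t) (avg (k.P r) w) x + avg (k.K r) w x := by
  obtain ⟨C, hC⟩ := h.bounded_above_of_compact_support hc
  set M := (k.K r).real univ + (k.K t).real univ + (k.K t).real univ + (k.K r).real univ with hM
  have hMn : 0 ≤ M := by positivity
  set X := avg (k.P t) (avg (k.K r) w) x + avg (k.K t) w x
      - (avg (k.K t) (avg (k.P r) w) x + avg (k.K r) w x) with hX
  suffices hs : ∀ ε > 0, |X| ≤ ε * M by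
    have : |X| ≤ 0 := by
      refine le_of_forall_pos_le_add (fun ε hε => ?_)
      have := hs (ε / (M + 1)) (by positivity)
      refine this.trans ?_
      rw [zero_add, div_mul_eq_mul_div, div_le_iff₀ (by positivity)]
      nlinarith
    have := abs_nonpos_iff.1 this
    linarith
  intro ε hε
  obtain ⟨g, hg, hgd, hgs⟩ := h.exists_contDiff_approx 2 (ε := fun _ => ε) (by fun_prop) (fun _ => hε)
  have hgc : HasCompactSupport g := hc.mono (hgs)
  obtain ⟨D, hD⟩ := hg.continuous.bounded_above_of_compact_support hgc
  have hd : ∀ y, |w y - g y| ≤ ε := fun y => by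
    have := (hgd y).le
    rw [Real.dist_eq, abs_sub_comm] at this
    exact this
  have key := k.comm_smooth hg hgc hr ht x
  have hdc : Continuous (fun y => w y - g y) := h.sub hg.continuous
  have s1 : ∀ (m : Measure (Euc N)) [IsFiniteMeasure m], avg m w
      = fun y => avg m (fun y => w y - g y) y + avg m g y := fun m _ => by
    ext y
    rw [avg_sub h.measurable hC hg.continuous.measurable hD]; ring
  have hX2 : X = avg (k.P t) (avg (k.K r) (fun y => w y - g y)) x + avg (k.K t) (fun y => w y - g y) x
      - avg (k.K t) (avg (k.P r) (fun y => w y - g y)) x - avg (k.K r) (fun y => w y - g y) x := by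
    rw [hX, s1 (k.K r), s1 (k.K t), s1 (k.P r),
      avg_add (avg_continuous hdc hd).measurable (avg_abs_le hd)
        (avg_continuous hg.continuous hD).measurable (avg_abs_le hD),
      avg_add (avg_continuous hdc hd).measurable (avg_abs_le hd)
        (avg_continuous hg.continuous hD).measurable (avg_abs_le hD)]
    linarith
  have a1 := avg_abs_le (m := k.P t) (avg_abs_le (m := k.K r) hd) x
  have a2 := avg_abs_le (m := k.K t) hd x
  have a3 := avg_abs_le (m := k.K t) (avg_abs_le (m := k.P r) hd) x
  have a4 := avg_abs_le (m := k.K r) hd x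
  simp only [probReal_univ, mul_one] at a1 a3
  rw [hX2, hM]
  rw [abs_le] at *
  constructor <;> nlinarith

end Ker

/-- local cutoff -/
lemma exists_cutoff {N : ℕ} {Ω : Set (Euc N)} (hΩ : IsOpen Ω) {W : Euc N → ℝ}
    (hW : ContDiffOn ℝ 2 W Ω) {x : Euc N} {r : ℝ} (hr : 0 < r) (hx : closedBall x (2*r) ⊆ Ω) :
    ∃ W' : Euc N → ℝ, ContDiff ℝ 2 W' ∧ HasCompactSupport W' ∧
      ∀ y ∈ closedBall x r, W' =ᶠ[𝓝 y] W := by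
  let b : ContDiffBump x := ⟨3/2*r, 2*r, by linarith, by linarith⟩
  refine ⟨fun y => b y * W y, ?_, b.hasCompactSupport.mul_right, ?_⟩
  · rw [contDiff_iff_contDiffAt]
    intro y
    by_cases hy : y ∈ Ω
    · exact b.contDiffAt.mul (hW.contDiffAt (hΩ.mem_nhds hy))
    · have : y ∉ tsupport b := by
        rw [b.tsupport_eq]; exact fun h => hy (hx h)
      have h0 := notMem_tsupport_iff_eventuallyEq.1 this
      refine (contDiffAt_const (c := (0:ℝ))).congr_of_eventuallyEq ?_
      filter_upwards [h0] with z hz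
      simp [hz]
  · intro y hy
    have : y ∈ ball x b.rIn := by
      simp only [mem_closedBall, mem_ball] at *
      show dist y x < 3/2*r
      linarith
    filter_upwards [b.eventuallyEq_one_of_mem_ball this] with z hz
    simp [hz]

lemma Ker.c2_local {N : ℕ} (k : Ker N) {Ω : Set (Euc N)} (hΩ : IsOpen Ω) {W a : Euc N → ℝ}
    (hW : ContDiffOn ℝ 2 W Ω) {x : Euc N} {r : ℝ} (hr : 0 < r) (hx : closedBall x (2*r) ⊆ Ω)
    (ha : ∀ y ∈ closedBall x r, -lap W y = a y) :
    W x = avg (k.P r) W x + avg (k.K r) a x := by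
  obtain ⟨W', h1, h2, h3⟩ := exists_cutoff hΩ hW hr hx
  have h4 := k.c2_id h1 h2 hr x
  rw [(h3 x (by simp [hr.le])).eq_of_nhds,
    avg_congr (k.P_supp hr.le) (fun y hy => (h3 y hy).eq_of_nhds),
    avg_congr (v := fun y => - a y) (k.K_supp r) (fun y hy => by
      rw [lap_congr (h3 y hy), ← ha y hy]; ring)] at h4
  have : avg (k.K r) (fun y => - a y) x = - avg (k.K r) a x := integral_neg _
  linarith


section reg
variable {N : ℕ} {F : Type} [NormedAddCommGroup F] [NormedSpace ℝ F]

/-- scaled average with vector-valued kernel -/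
def QQ (h : Euc N → ℝ) (ψ : Euc N → F) (s : ℝ) (x : Euc N) : F := ∫ y, h (x + s • y) • ψ y

lemma QQ_eq (h : Euc N → ℝ) (ψ : Euc N → F) {s : ℝ} (hs : 0 < s) (x : Euc N) :
    QQ h ψ s x = |(s ^ Module.finrank ℝ (Euc N))⁻¹| • ∫ z, h z • ψ (s⁻¹ • (z - x)) := by
  unfold QQ
  have h1 := Measure.integral_comp_smul (volume : Measure (Euc N))
    (fun y => h (x + y) • ψ (s⁻¹ • y)) s
  simp only [smul_smul, inv_mul_cancel₀ hs.ne', one_smul] at h1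
  rw [h1]
  congr 1
  rw [← integral_add_left_eq_self (fun z => h z • ψ (s⁻¹ • (z - x))) x]
  simp

lemma QQ_hasFDerivAt {h : Euc N → ℝ} (hh : Integrable h) {ψ : Euc N → F} (hψ : ContDiff ℝ 1 ψ)
    (hψs : HasCompactSupport ψ) {s : ℝ} (hs : 0 < s) (x : Euc N) :
    HasFDerivAt (QQ h ψ s) (-(s⁻¹) • QQ h (fderiv ℝ ψ) s x) x := by
  have e : QQ h ψ s = fun x => |(s ^ Module.finrank ℝ (Euc N))⁻¹| •
      ∫ z, h z • ψ (s⁻¹ • (z - x)) := by ext x; exact QQ_eq h ψ hs x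
  rw [e, QQ_eq h _ hs, smul_comm]
  refine HasFDerivAt.const_smul ?_ _
  rw [← integral_smul]
  have hc : Continuous (fderiv ℝ ψ) := hψ.continuous_fderiv (by norm_num)
  obtain ⟨D, hD⟩ := hc.bounded_above_of_compact_support (hψs.fderiv ℝ)
  obtain ⟨D0, hD0⟩ := hψ.continuous.bounded_above_of_compact_support hψs
  have hψc := hψ.continuous
  refine hasFDerivAt_integral_of_dominated_of_fderiv_le (𝕜 := ℝ) (s := univ) (x₀ := x)
    (μ := (volume : Measure (Euc N)))
    (F := fun x z => h z • ψ (s⁻¹ • (z - x)))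
    (F' := fun x z => -(s⁻¹) • h z • fderiv ℝ ψ (s⁻¹ • (z - x)))
    (bound := fun z => |h z| * (s⁻¹ * D)) univ_mem ?_ ?_ ?_ ?_ ?_ ?_
  · refine Eventually.of_forall fun x => ?_
    exact hh.aestronglyMeasurable.smul (Continuous.aestronglyMeasurable (by fun_prop))
  · refine (hh.norm.mul_const D0).mono'
      (hh.aestronglyMeasurable.smul (Continuous.aestronglyMeasurable (by fun_prop))) ?_
    refine Eventually.of_forall fun z => ?_
    rw [norm_smul]
    exact mul_le_mul_of_nonneg_left (hD0 _) (norm_nonneg _)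
  · have hcc : Continuous (fun z => fderiv ℝ ψ (s⁻¹ • (z - x))) := by fun_prop
    exact (hh.aestronglyMeasurable.smul hcc.aestronglyMeasurable).const_smul (-(s⁻¹))
  · refine Eventually.of_forall fun z x _ => ?_
    rw [norm_smul, norm_smul, norm_neg, Real.norm_of_nonneg (inv_pos.2 hs).le, Real.norm_eq_abs]
    have := hD (s⁻¹ • (z - x))
    have h2 : 0 ≤ s⁻¹ := (inv_pos.2 hs).le
    calc s⁻¹ * (|h z| * ‖fderiv ℝ ψ (s⁻¹ • (z - x))‖) ≤ s⁻¹ * (|h z| * D) := by gcongr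
      _ = _ := by ring
  · exact hh.norm.mul_const _
  · refine Eventually.of_forall fun z x _ => ?_
    have h1 : HasFDerivAt (fun x : Euc N => s⁻¹ • (z - x))
        (s⁻¹ • (-ContinuousLinearMap.id ℝ (Euc N))) x := by
      have h0 : HasFDerivAt (fun x : Euc N => z - x) (-ContinuousLinearMap.id ℝ (Euc N)) x :=
        (hasFDerivAt_id x).const_sub z
      exact h0.const_smul s⁻¹
    have h2 := ((hψ.differentiable (by norm_num) (s⁻¹ • (z - x))).hasFDerivAt.comp x h1).const_smul (h z)
    refine h2.congr_fderiv ?_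
    ext v
    simp
    rw [smul_comm]

lemma QQ_bound {h : Euc N → ℝ} {ψ : Euc N → F} (hψ : Integrable ψ) {H s : ℝ} {x : Euc N}
    (hH : ∀ y, ‖y‖ ≤ 1 → |h (x + s • y)| ≤ H) (hψs : ∀ y, 1 ≤ ‖y‖ → ψ y = 0) :
    ‖QQ h ψ s x‖ ≤ H * ∫ y, ‖ψ y‖ := by
  unfold QQ
  rw [← integral_const_mul]
  refine norm_integral_le_of_norm_le (hψ.norm.const_mul H) (Eventually.of_forall fun y => ?_)
  rw [norm_smul]
  by_cases hy : 1 ≤ ‖y‖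
  · simp [hψs y hy]
  · exact mul_le_mul_of_nonneg_right (hH y (not_le.1 hy).le) (norm_nonneg _)

lemma QQ_bound' {h : Euc N → ℝ} (hh : Measurable h) {M : ℝ} (hM : ∀ x, |h x| ≤ M)
    {ψ : Euc N → F} (hψ : Integrable ψ) {H s : ℝ} {x : Euc N}
    (hH : ∀ y, ‖y‖ ≤ 1 → |h (x + s • y) - h x| ≤ H) (hψs : ∀ y, 1 ≤ ‖y‖ → ψ y = 0)
    (h0 : ∫ y, ψ y = 0) :
    ‖QQ h ψ s x‖ ≤ H * ∫ y, ‖ψ y‖ := by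
  have : QQ h ψ s x = QQ (fun z => h z - h x) ψ s x := by
    unfold QQ
    simp_rw [sub_smul]
    rw [integral_sub, integral_smul, h0]
    · simp
    · refine (hψ.norm.const_mul M).mono' ?_ (Eventually.of_forall fun y => ?_)
      · exact (Measurable.aestronglyMeasurable (by fun_prop)).smul hψ.aestronglyMeasurable
      · rw [norm_smul]
        exact mul_le_mul_of_nonneg_right (hM _) (norm_nonneg _)
    · exact hψ.smul _
  rw [this]
  exact QQ_bound hψ hH hψs

lemma QQ_meas {h : Euc N → ℝ} (hh : Measurable h) {ψ : Euc N → F} (hψ : Continuous ψ) (x : Euc N) :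
    StronglyMeasurable (fun s => QQ h ψ s x) := by
  unfold QQ
  refine StronglyMeasurable.integral_prod_right
    (f := fun (s : ℝ) (y : Euc N) => h (x + s • y) • ψ y) ?_
  simp only [Function.uncurry_def]
  refine StronglyMeasurable.smul (Measurable.stronglyMeasurable (by fun_prop)) ?_
  exact (hψ.comp continuous_snd).stronglyMeasurable

/-- integral over scales -/
def GG (h : Euc N → ℝ) (ω : ℝ → ℝ) (ψ : Euc N → F) (r : ℝ) (x : Euc N) : F :=
  ∫ s in Ioo 0 r, ω s • QQ h ψ s x

lemma GG_hasFDerivAt {h : Euc N → ℝ} (hm : Measurable h) (hh : Integrable h) {ψ : Euc N → F}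
    (hψ : ContDiff ℝ 1 ψ) (hψs : HasCompactSupport ψ) {ω : ℝ → ℝ} (hω : Measurable ω) {r : ℝ}
    {U : Set (Euc N)} (hU : IsOpen U) {b b0 : ℝ → ℝ} (hb : IntegrableOn b (Ioo 0 r))
    (hb0 : IntegrableOn b0 (Ioo 0 r))
    (h0 : ∀ x ∈ U, ∀ s ∈ Ioo 0 r, ‖ω s • QQ h ψ s x‖ ≤ b0 s)
    (h1 : ∀ x ∈ U, ∀ s ∈ Ioo 0 r, ‖(ω s * -(s⁻¹)) • QQ h (fderiv ℝ ψ) s x‖ ≤ b s)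
    {x : Euc N} (hx : x ∈ U) :
    HasFDerivAt (GG h ω ψ r) (GG h (fun s => ω s * -(s⁻¹)) (fderiv ℝ ψ) r x) x := by
  have hc : Continuous (fderiv ℝ ψ) := hψ.continuous_fderiv (by norm_num)
  refine hasFDerivAt_integral_of_dominated_of_fderiv_le (𝕜 := ℝ) (s := U) (x₀ := x)
    (μ := volume.restrict (Ioo 0 r))
    (F := fun x s => ω s • QQ h ψ s x)
    (F' := fun x s => (ω s * -(s⁻¹)) • QQ h (fderiv ℝ ψ) s x)
    (bound := b) (hU.mem_nhds hx) ?_ ?_ ?_ ?_ hb ?_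
  · refine Eventually.of_forall fun x => ?_
    exact (hω.stronglyMeasurable.smul (QQ_meas hm hψ.continuous x)).aestronglyMeasurable
  · refine hb0.mono' (hω.stronglyMeasurable.smul (QQ_meas hm hψ.continuous x)).aestronglyMeasurable ?_
    exact (ae_restrict_iff' measurableSet_Ioo).2 (Eventually.of_forall fun s hs => h0 x hx s hs)
  · have hω' : Measurable (fun s => ω s * -(s⁻¹)) := hω.mul measurable_inv.neg
    exact (hω'.stronglyMeasurable.smul (QQ_meas hm hc x)).aestronglyMeasurable
  · exact (ae_restrict_iff' measurableSet_Ioo).2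
      (Eventually.of_forall fun s hs x hx => h1 x hx s hs)
  · refine (ae_restrict_iff' measurableSet_Ioo).2 (Eventually.of_forall fun s hs x hx => ?_)
    rw [mul_smul]
    exact (QQ_hasFDerivAt hh hψ hψs hs.1 x).const_smul _

lemma GG_cont {h : Euc N → ℝ} (hm : Measurable h) (hh : Integrable h) {ψ : Euc N → F}
    (hψ : ContDiff ℝ 1 ψ) (hψs : HasCompactSupport ψ) {ω : ℝ → ℝ} (hω : Measurable ω) {r : ℝ}
    {U : Set (Euc N)} {b0 : ℝ → ℝ}
    (hb0 : IntegrableOn b0 (Ioo 0 r))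
    (h0 : ∀ x ∈ U, ∀ s ∈ Ioo 0 r, ‖ω s • QQ h ψ s x‖ ≤ b0 s) :
    ContinuousOn (GG h ω ψ r) U := by
  refine continuousOn_of_dominated (bound := b0) ?_ ?_ hb0 ?_
  · intro x hx
    exact (hω.stronglyMeasurable.smul (QQ_meas hm hψ.continuous x)).aestronglyMeasurable
  · intro x hx
    exact (ae_restrict_iff' measurableSet_Ioo).2 (Eventually.of_forall fun s hs => h0 x hx s hs)
  · refine (ae_restrict_iff' measurableSet_Ioo).2 (Eventually.of_forall fun s hs => ?_)
    have : Continuous (QQ h ψ s) := continuous_iff_continuousAt.2 fun x =>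
      (QQ_hasFDerivAt hh hψ hψs hs.1 x).continuousAt
    exact (this.const_smul _).continuousOn

lemma contDiffOn_two_of {f : Euc N → ℝ} {f' : Euc N → (Euc N →L[ℝ] ℝ)}
    {f'' : Euc N → (Euc N →L[ℝ] (Euc N →L[ℝ] ℝ))} {U : Set (Euc N)} (hU : IsOpen U)
    (h1 : ∀ x ∈ U, HasFDerivAt f (f' x) x) (h2 : ∀ x ∈ U, HasFDerivAt f' (f'' x) x)
    (h3 : ContinuousOn f'' U) : ContDiffOn ℝ 2 f U := by
  have e : (2 : WithTop ℕ∞) = 1 + 1 := by norm_num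
  rw [e, contDiffOn_succ_iff_fderiv_of_isOpen hU]
  refine ⟨fun x hx => (h1 x hx).differentiableAt.differentiableWithinAt, by simp, ?_⟩
  refine ContDiffOn.congr (f := f') ?_ (fun x hx => (h1 x hx).fderiv)
  have e : (1 : WithTop ℕ∞) = 0 + 1 := by norm_num
  rw [e, contDiffOn_succ_iff_fderiv_of_isOpen hU]
  refine ⟨fun x hx => (h2 x hx).differentiableAt.differentiableWithinAt, by simp, ?_⟩
  refine ContDiffOn.congr (f := f'') ?_ (fun x hx => (h2 x hx).fderiv)
  exact contDiffOn_zero.2 h3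

lemma fderiv_supp {ψ : Euc N → F} (hψ : ContDiff ℝ 1 ψ) (hψs : ∀ y, 1 ≤ ‖y‖ → ψ y = 0) :
    ∀ y, 1 ≤ ‖y‖ → fderiv ℝ ψ y = 0 := by
  have hc : Continuous (fderiv ℝ ψ) := hψ.continuous_fderiv (by norm_num)
  have hopen : ∀ y, 1 < ‖y‖ → fderiv ℝ ψ y = 0 := by
    intro y hy
    have : ψ =ᶠ[𝓝 y] (fun _ => (0:F)) := by
      have hn : {z : Euc N | 1 < ‖z‖} ∈ 𝓝 y := (isOpen_lt continuous_const continuous_norm).mem_nhds hy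
      filter_upwards [hn] with z hz using hψs z (le_of_lt hz)
    rw [this.fderiv_eq]; simp
  intro y hy
  have hlim : Tendsto (fun n : ℕ => fderiv ℝ ψ ((1 + 1/((n:ℝ)+1)) • y)) atTop (𝓝 (fderiv ℝ ψ y)) := by
    have h1 : Tendsto (fun n : ℕ => (1 + 1/((n:ℝ)+1)) • y) atTop (𝓝 y) := by
      have := (tendsto_one_div_add_atTop_nhds_zero_nat (𝕜 := ℝ)).const_add 1
      simpa using this.smul_const y
    exact (hc.tendsto y).comp h1
  have hz : (fun n : ℕ => fderiv ℝ ψ ((1 + 1/((n:ℝ)+1)) • y)) = fun _ => 0 := by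
    ext1 n
    apply hopen
    have : (0:ℝ) < 1/((n:ℝ)+1) := by positivity
    rw [norm_smul, Real.norm_of_nonneg (by positivity)]
    nlinarith
  rw [hz] at hlim
  exact tendsto_nhds_unique hlim tendsto_const_nhds

lemma int_fderiv_zero [CompleteSpace F] {ψ : Euc N → F} (hψ : ContDiff ℝ 1 ψ) (hψs : HasCompactSupport ψ) :
    ∫ y, fderiv ℝ ψ y = 0 := by
  have hc : Continuous (fderiv ℝ ψ) := hψ.continuous_fderiv (by norm_num)
  have hi : Integrable (fderiv ℝ ψ) := hc.integrable_of_hasCompactSupport (hψs.fderiv ℝ)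
  ext v
  rw [ContinuousLinearMap.integral_apply hi]
  have := integral_smul_fderiv_eq_neg_fderiv_smul_of_integrable (μ := (volume : Measure (Euc N)))
    (f := fun _ => (1:ℝ)) (g := ψ) (v := v) (by simp) ?_ ?_ (by simp)
    (fun y _ => hψ.differentiable (by norm_num) y)
  · simpa using this
  · simpa using hi.apply_continuousLinearMap v
  · simpa using hψ.continuous.integrable_of_hasCompactSupport hψs

end reg


section reg6
variable {N : ℕ} (k : Ker N)

lemma ioo_const (r c : ℝ) : IntegrableOn (fun _ : ℝ => c) (Ioo 0 r) :=
  integrableOn_const (by simp)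

lemma norm_smul_F {F : Type} [NormedAddCommGroup F] [NormedSpace ℝ F] (c : ℝ) (x : F) :
    ‖c • x‖ = ‖c‖ * ‖x‖ := norm_smul c x

/-- scaled QQ -/
def QS {F : Type} [NormedAddCommGroup F] [NormedSpace ℝ F] (c : ℝ) (h : Euc N → ℝ)
    (ψ : Euc N → F) (s : ℝ) (x : Euc N) : F := c • QQ h ψ s x

lemma QS_hasFDerivAt {F : Type} [NormedAddCommGroup F] [NormedSpace ℝ F] {h : Euc N → ℝ}
    (hh : Integrable h) {ψ : Euc N → F} (hψ : ContDiff ℝ 1 ψ)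
    (hψs : HasCompactSupport ψ) {s : ℝ} (hs : 0 < s) (c : ℝ) (x : Euc N) :
    HasFDerivAt (QS c h ψ s) (QS (c * -(s⁻¹)) h (fderiv ℝ ψ) s x) x := by
  unfold QS
  rw [mul_smul]
  exact (QQ_hasFDerivAt hh hψ hψs hs x).const_smul c

lemma QQ_hasFDerivAt' {F : Type} [NormedAddCommGroup F] [NormedSpace ℝ F] {h : Euc N → ℝ}
    (hh : Integrable h) {ψ : Euc N → F} (hψ : ContDiff ℝ 1 ψ)
    (hψs : HasCompactSupport ψ) {s : ℝ} (hs : 0 < s) (x : Euc N) :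
    HasFDerivAt (QQ h ψ s) (QS (-(s⁻¹)) h (fderiv ℝ ψ) s x) x :=
  QQ_hasFDerivAt hh hψ hψs hs x

lemma GGbd {F : Type} [NormedAddCommGroup F] [NormedSpace ℝ F] {h : Euc N → ℝ} (hm : Measurable h)
    {H : ℝ} (hH : ∀ x, |h x| ≤ H) {ψ : Euc N → F} (hI : Integrable ψ)
    (hs : ∀ y, 1 ≤ ‖y‖ → ψ y = 0) (h0 : ∫ y, ψ y = 0) {C α r : ℝ} (hα : 0 < α) (hC0 : 0 ≤ C)
    {x : Euc N} (hC : ∀ z, ‖z‖ ≤ r → |h (x + z) - h x| ≤ C * ‖z‖ ^ α) {s : ℝ} (hs' : s ∈ Ioo 0 r) :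
    ‖(s * -(s⁻¹) * -(s⁻¹)) • QQ h ψ s x‖ ≤ s ^ (α - 1) * (C * ∫ y, ‖ψ y‖) := by
  have hs0 := hs'.1
  rw [norm_smul]
  have h1 : ‖s * -(s⁻¹) * -(s⁻¹)‖ = s⁻¹ := by
    have : s * -(s⁻¹) * -(s⁻¹) = s⁻¹ := by field_simp
    rw [this, Real.norm_of_nonneg (inv_pos.2 hs0).le]
  have h2 := QQ_bound' (x := x) (s := s) (H := C * s ^ α) hm hH hI ?_ hs h0
  · rw [h1]
    calc _ ≤ s⁻¹ * (C * s ^ α * ∫ y, ‖ψ y‖) := by gcongr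
      _ = _ := by rw [Real.rpow_sub_one hs0.ne']; ring
  · intro y hy
    have hn : ‖s • y‖ ≤ s := by
      rw [norm_smul, Real.norm_of_nonneg hs0.le]; nlinarith
    refine (hC (s • y) (hn.trans hs'.2.le)).trans ?_
    gcongr

lemma Ker.p_cs : HasCompactSupport k.p := hasCompactSupport_of_ball k.p_supp
lemma Ker.q_cs : HasCompactSupport k.q := hasCompactSupport_of_ball k.q_supp

lemma Ker.avg_P_eq {h : Euc N → ℝ} (hm : Measurable h) (r : ℝ) :
    avg (k.P r) h = QQ h k.p r := by
  ext x
  rw [k.avg_P hm]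
  unfold QQ
  simp only [smul_eq_mul, mul_comm]

lemma Ker.avg_K_eq {h : Euc N → ℝ} (hm : Measurable h) {H : ℝ} (hH : ∀ x, |h x| ≤ H) (r : ℝ) :
    avg (k.K r) h = GG h (fun s => s) k.q r := by
  ext x
  rw [k.avg_K hm hH]
  unfold GG QQ
  simp only [smul_eq_mul, mul_comm]

lemma contDiff_fderiv' {F : Type} [NormedAddCommGroup F] [NormedSpace ℝ F] {ψ : Euc N → F} {n : ℕ}
    (h : ContDiff ℝ (n+1 : ℕ) ψ) : ContDiff ℝ (n : ℕ) (fderiv ℝ ψ) :=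
  h.fderiv_right (by norm_cast)

lemma lip_of_deriv {f : Euc N → ℝ} {f' : Euc N → (Euc N →L[ℝ] ℝ)} {C : ℝ}
    (h : ∀ x, HasFDerivAt f (f' x) x) (hC : ∀ x, ‖f' x‖ ≤ C) (x y : Euc N) :
    |f x - f y| ≤ C * ‖x - y‖ := by
  have := Convex.norm_image_sub_le_of_norm_hasFDerivWithin_le (s := univ)
    (fun x _ => (h x).hasFDerivWithinAt) (fun x _ => hC x) convex_univ (mem_univ y) (mem_univ x)
  simpa using this

lemma Ker.P_lip {h : Euc N → ℝ} (hm : Measurable h) (hi : Integrable h) {H : ℝ}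
    (hH : ∀ x, |h x| ≤ H) {r : ℝ} (hr : 0 < r) :
    ∃ L, ∀ x y, |avg (k.P r) h x - avg (k.P r) h y| ≤ L * ‖x - y‖ := by
  rw [k.avg_P_eq hm]
  have hp1 : ContDiff ℝ 1 k.p := k.p_smooth.of_le (by norm_num)
  have hc := hp1.continuous_fderiv (by norm_num)
  refine ⟨_, lip_of_deriv (fun x => QQ_hasFDerivAt hi hp1 k.p_cs hr x) (C := ‖-(r⁻¹)‖ * (H * ∫ y, ‖fderiv ℝ k.p y‖)) fun x => ?_⟩
  rw [norm_smul]
  refine mul_le_mul_of_nonneg_left ?_ (norm_nonneg _)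
  exact QQ_bound (hc.integrable_of_hasCompactSupport (k.p_cs.fderiv ℝ)) (fun y _ => hH _)
    (fderiv_supp hp1 k.p_supp)

lemma Ker.P_c2 {h : Euc N → ℝ} (hm : Measurable h) (hi : Integrable h) {r : ℝ} (hr : 0 < r) :
    ContDiff ℝ 2 (avg (k.P r) h) := by
  rw [k.avg_P_eq hm]
  have hp1 : ContDiff ℝ 1 k.p := k.p_smooth.of_le (by norm_num)
  have hp2 : ContDiff ℝ 2 (fderiv ℝ k.p) := contDiff_fderiv' (n := 2) k.p_smooth
  have hp2' : ContDiff ℝ 1 (fderiv ℝ k.p) := hp2.of_le (by norm_num)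
  have hp3 : ContDiff ℝ 1 (fderiv ℝ (fderiv ℝ k.p)) := contDiff_fderiv' (n := 1) hp2
  have c2 := k.p_cs.fderiv ℝ
  have c3 := c2.fderiv ℝ
  rw [← contDiffOn_univ]
  refine contDiffOn_two_of isOpen_univ
    (fun x _ => QQ_hasFDerivAt' hi hp1 k.p_cs hr x)
    (fun x _ => QS_hasFDerivAt hi hp2' c2 hr _ x) ?_
  exact (continuous_iff_continuousAt.2 fun x =>
    (QS_hasFDerivAt hi hp3 c3 hr _ x).continuousAt).continuousOn

lemma Ker.K_deriv {h : Euc N → ℝ} (hm : Measurable h) (hi : Integrable h) {H : ℝ}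
    (hH : ∀ x, |h x| ≤ H) {r : ℝ} (x : Euc N) :
    HasFDerivAt (avg (k.K r) h) (GG h (fun s => s * -(s⁻¹)) (fderiv ℝ k.q) r x) x := by
  rw [k.avg_K_eq hm hH]
  have hp1 : ContDiff ℝ 1 k.q := k.q_smooth.of_le (by norm_num)
  have hc := hp1.continuous_fderiv (by norm_num)
  have hI0 := hp1.continuous.integrable_of_hasCompactSupport k.q_cs (μ := volume)
  have hI1 := hc.integrable_of_hasCompactSupport (k.q_cs.fderiv ℝ) (μ := volume)
  refine GG_hasFDerivAt hm hi hp1 k.q_cs measurable_id (U := univ) isOpen_univ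
    (b0 := fun s => r * (H * ∫ y, ‖k.q y‖)) (b := fun s => 1 * (H * ∫ y, ‖fderiv ℝ k.q y‖))
    (ioo_const _ _) (ioo_const _ _) ?_ ?_ (mem_univ x)
  · intro x _ s hs
    rw [norm_smul]
    have h1 : ‖id s‖ ≤ r := by simpa [abs_of_pos hs.1] using hs.2.le
    have h2 := QQ_bound (x := x) (s := s) hI0 (fun y _ => hH _) k.q_supp
    exact mul_le_mul h1 h2 (norm_nonneg _) (le_trans (norm_nonneg _) h1)
  · intro x _ s hs
    rw [norm_smul]
    have h1 : ‖id s * -(s⁻¹)‖ ≤ 1 := by simp [hs.1.ne']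
    have h2 := QQ_bound (x := x) (s := s) hI1 (fun y _ => hH _) (fderiv_supp hp1 k.q_supp)
    exact mul_le_mul h1 h2 (norm_nonneg _) (le_trans (norm_nonneg _) h1)

lemma Ker.K_lip {h : Euc N → ℝ} (hm : Measurable h) (hi : Integrable h) {H : ℝ}
    (hH : ∀ x, |h x| ≤ H) (r : ℝ) :
    ∃ L, ∀ x y, |avg (k.K r) h x - avg (k.K r) h y| ≤ L * ‖x - y‖ := by
  have hp1 : ContDiff ℝ 1 k.q := k.q_smooth.of_le (by norm_num)
  have hc := hp1.continuous_fderiv (by norm_num)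
  have hI1 := hc.integrable_of_hasCompactSupport (k.q_cs.fderiv ℝ) (μ := volume)
  refine ⟨_, lip_of_deriv (fun x => k.K_deriv hm hi hH x)
    (C := (1 * (H * ∫ y, ‖fderiv ℝ k.q y‖)) * (volume : Measure ℝ).real (Ioo 0 r)) fun x => ?_⟩
  refine norm_setIntegral_le_of_norm_le_const (by simp) ?_
  intro s hs
  rw [norm_smul]
  have h1 : ‖s * -(s⁻¹)‖ ≤ 1 := by simp [hs.1.ne']
  have h2 := QQ_bound (x := x) (s := s) hI1 (fun y _ => hH _) (fderiv_supp hp1 k.q_supp)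
  exact mul_le_mul h1 h2 (norm_nonneg _) (le_trans (norm_nonneg _) h1)

lemma Ker.K_c2 {h : Euc N → ℝ} (hm : Measurable h) (hi : Integrable h) {H : ℝ}
    (hH : ∀ x, |h x| ≤ H) {r : ℝ} {U : Set (Euc N)} (hU : IsOpen U) {C α : ℝ} (hα : 0 < α)
    (hC : ∀ x ∈ U, ∀ z, ‖z‖ ≤ r → |h (x + z) - h x| ≤ C * ‖z‖ ^ α) (hC0 : 0 ≤ C) :
    ContDiffOn ℝ 2 (avg (k.K r) h) U := by
  have hp1 : ContDiff ℝ 1 k.q := k.q_smooth.of_le (by norm_num)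
  have hp2 : ContDiff ℝ 2 (fderiv ℝ k.q) := contDiff_fderiv' (n := 2) k.q_smooth
  have hp2' : ContDiff ℝ 1 (fderiv ℝ k.q) := hp2.of_le (by norm_num)
  have hp3 : ContDiff ℝ 1 (fderiv ℝ (fderiv ℝ k.q)) := contDiff_fderiv' (n := 1) hp2
  have c2 := k.q_cs.fderiv ℝ
  have c3 := c2.fderiv ℝ
  have hI2 := hp2.continuous.integrable_of_hasCompactSupport c2 (μ := volume)
  have hI3 := hp3.continuous.integrable_of_hasCompactSupport c3 (μ := volume)
  have s2 := fderiv_supp hp1 k.q_supp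
  have s3 := fderiv_supp hp2' s2
  have hz := int_fderiv_zero hp2' c2
  have hωm : Measurable (fun s : ℝ => s * -(s⁻¹)) := measurable_id.mul measurable_inv.neg
  have hωm2 : Measurable (fun s : ℝ => s * -(s⁻¹) * -(s⁻¹)) := hωm.mul measurable_inv.neg
  have hb : IntegrableOn (fun s => s ^ (α - 1) * (C * ∫ y, ‖fderiv ℝ (fderiv ℝ k.q) y‖)) (Ioo 0 r) := by
    apply Integrable.mul_const
    rcases le_or_gt r 0 with hr | hr
    · simp [hr]
    · exact (intervalIntegral.integrableOn_Ioo_rpow_iff hr).2 (by linarith)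
  refine contDiffOn_two_of hU (fun x _ => k.K_deriv hm hi hH x)
    (fun x hx => GG_hasFDerivAt hm hi hp2' c2 hωm hU hb
      (b0 := fun s => 1 * (H * ∫ y, ‖fderiv ℝ k.q y‖)) (ioo_const _ _) ?_
      (fun x hx s hs => GGbd hm hH hI3 s3 hz hα hC0 (hC x hx) hs) hx) ?_
  · intro x _ s hs
    rw [norm_smul]
    have h1 : ‖s * -(s⁻¹)‖ ≤ 1 := by simp [hs.1.ne']
    have h2 := QQ_bound (x := x) (s := s) hI2 (fun y _ => hH _) s2
    exact mul_le_mul h1 h2 (norm_nonneg _) (le_trans (norm_nonneg _) h1)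
  · exact GG_cont hm hi hp3 c3 hωm2 hb (fun x hx s hs => GGbd hm hH hI3 s3 hz hα hC0 (hC x hx) hs)

end reg6


section ex
variable {N : ℕ}

lemma int_cont {m : Measure (Euc N)} [IsFiniteMeasure m] {r : ℝ} (hm : ∀ᵐ z ∂m, ‖z‖ ≤ r)
    {w : Euc N → ℝ} (hw : Continuous w) (x : Euc N) : Integrable (fun z => w (x + z)) m := by
  obtain ⟨C, hC⟩ := (isCompact_closedBall x r).exists_bound_of_continuousOn hw.continuousOn
  refine Integrable.of_bound (C := C) (Continuous.aestronglyMeasurable (by fun_prop)) ?_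
  filter_upwards [hm] with z hz
  exact hC _ (by simpa [mem_closedBall, dist_eq_norm] using hz)

lemma lap_normsq (x : Euc N) : lap (fun y : Euc N => ‖y‖ ^ 2) x = 2 * N := by
  unfold lap
  have : ∀ i, secondDerivCoord (fun y : Euc N => ‖y‖ ^ 2) i x = 2 := by
    intro i
    unfold secondDerivCoord
    have h1 : (fun t : ℝ => fderiv ℝ (fun y : Euc N => ‖y‖ ^ 2)
        (x + t • (EuclideanSpace.single i (1:ℝ))) (EuclideanSpace.single i (1:ℝ)))
        = fun t => 2 * (x i + t) := by
      ext t
      rw [fderiv_norm_sq_apply]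
      simp [EuclideanSpace.inner_single_right]
      ring
    rw [h1]
    simp
  simp [this, mul_comm]

lemma min_principle (hN : 0 < N) (k : Ker N) {Ω : Set (Euc N)} 
    (hb : Bornology.IsBounded Ω) {w : Euc N → ℝ} (hw : Continuous w) (h0 : ∀ x, x ∉ Ω → w x = 0)
    (hs : ∀ x ∈ Ω, ∃ r, 0 < r ∧ closedBall x r ⊆ Ω ∧ avg (k.P r) w x ≤ w x) (x : Euc N) :
    0 ≤ w x := by
  by_contra! hx
  have hxΩ : x ∈ Ω := by
    by_contra h
    rw [h0 x h] at hx; exact lt_irrefl _ hx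
  obtain ⟨R, hR⟩ := hb.closure.exists_norm_le
  have hR0 : 0 ≤ R := (norm_nonneg _).trans (hR x (subset_closure hxΩ))
  obtain ⟨δ, hδ, hδ2⟩ : ∃ δ : ℝ, 0 < δ ∧ δ * R ^ 2 < - w x := by
    refine ⟨- w x / (2 * (R ^ 2 + 1)), by apply div_pos <;> [linarith; positivity], ?_⟩
    rw [div_mul_eq_mul_div, div_lt_iff₀ (by positivity)]
    nlinarith [sq_nonneg R]
  have hc : IsCompact (closure Ω) := hb.isCompact_closure
  have hnc : Continuous fun y : Euc N => ‖y‖ ^ 2 := by fun_prop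
  obtain ⟨y, hy, hmin⟩ := hc.exists_isMinOn ⟨x, subset_closure hxΩ⟩
    (f := fun y => w y - δ * ‖y‖ ^ 2) (by fun_prop)
  have hyx := hmin (subset_closure hxΩ)
  simp only [mem_ofPred_eq] at hyx
  have hyΩ : y ∈ Ω := by
    by_contra h
    rw [h0 y h] at hyx
    have h1 : ‖y‖ ^ 2 ≤ R ^ 2 := by gcongr; exact hR y hy
    have : 0 ≤ δ * ‖x‖ ^ 2 := by positivity
    nlinarith
  obtain ⟨r, hr, hball, hav⟩ := hs y hyΩ
  have e := k.c2_local isOpen_univ (W := fun y => ‖y‖ ^ 2) (a := fun _ => -(2 * (N:ℝ))) (x := y)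
    (r := r) ((contDiff_norm_sq ℝ).contDiffOn) hr (subset_univ _) (fun z _ => by rw [lap_normsq])
  have e2 : avg (k.K r) (fun _ => -(2 * (N:ℝ))) y = -(2 * N) * (k.K r).real univ := by
    simp [avg, mul_comm]
  have hm := k.K_mass hr
  have hN' : (0:ℝ) < N := by exact_mod_cast hN
  have e3 : ‖y‖ ^ 2 < avg (k.P r) (fun y => ‖y‖ ^ 2) y := by
    rw [e2] at e
    have : 0 < 2 * (N:ℝ) * (k.K r).real univ := by positivity
    linarith
  have i1 := int_cont (k.P_supp hr.le) hw y
  have i2 := int_cont (k.P_supp hr.le) hnc y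
  have e4 : w y - δ * ‖y‖ ^ 2 ≤ avg (k.P r) w y - δ * avg (k.P r) (fun y => ‖y‖ ^ 2) y := by
    unfold avg
    rw [← integral_const_mul, ← integral_sub i1 (i2.const_mul δ)]
    have : ∫ _, (w y - δ * ‖y‖ ^ 2) ∂(k.P r) = w y - δ * ‖y‖ ^ 2 := by simp
    rw [← this]
    refine integral_mono_ae (integrable_const _) (i1.sub (i2.const_mul δ)) ?_
    filter_upwards [k.P_supp hr.le] with z hz
    exact hmin (subset_closure (hball (by simpa [mem_closedBall, dist_eq_norm] using hz)))
  nlinarith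

def rho (j : ℕ) : ℝ := 1 / ((j:ℝ) + 1)

lemma rho_pos (j : ℕ) : 0 < rho j := by unfold rho; positivity

lemma rho_tendsto : Tendsto rho atTop (𝓝 0) := tendsto_one_div_add_atTop_nhds_zero_nat

lemma exists_rho {Ω : Set (Euc N)} (ho : IsOpen Ω) {x : Euc N} (hx : x ∈ Ω) (c : ℝ) :
    ∃ j, closedBall x (c * rho j) ⊆ Ω := by
  obtain ⟨e, he, h⟩ := Metric.isOpen_iff.1 ho x hx
  have := (rho_tendsto.const_mul c)
  rw [mul_zero] at this
  obtain ⟨j, hj⟩ := (this.eventually (gt_mem_nhds he)).exists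
  exact ⟨j, (closedBall_subset_ball hj).trans h⟩

def chi (Ω : Set (Euc N)) (j : ℕ) (x : Euc N) : ℝ :=
  min 1 (max 0 ((infDist x Ωᶜ - 2 * rho j) / rho j))

lemma chi_cont (Ω : Set (Euc N)) (j : ℕ) : Continuous (chi Ω j) := by
  unfold chi
  have := continuous_infDist_pt (Ωᶜ)
  have h : Continuous (fun x => (infDist x Ωᶜ - 2 * rho j) / rho j) := by
    exact (this.sub continuous_const).div_const _
  fun_prop

lemma chi_nonneg (Ω : Set (Euc N)) (j : ℕ) (x : Euc N) : 0 ≤ chi Ω j x :=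
  le_min zero_le_one (le_max_left _ _)

lemma chi_le (Ω : Set (Euc N)) (j : ℕ) (x : Euc N) : chi Ω j x ≤ 1 := min_le_left _ _

lemma chi_zero (Ω : Set (Euc N)) (j : ℕ) (x : Euc N) (h : infDist x Ωᶜ ≤ 2 * rho j) :
    chi Ω j x = 0 := by
  have : (infDist x Ωᶜ - 2 * rho j) / rho j ≤ 0 :=
    div_nonpos_of_nonpos_of_nonneg (by linarith) (rho_pos j).le
  simp [chi, max_eq_left this]

lemma chi_one (Ω : Set (Euc N)) (j : ℕ) (x : Euc N) (h : 3 * rho j ≤ infDist x Ωᶜ) :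
    chi Ω j x = 1 := by
  have : 1 ≤ (infDist x Ωᶜ - 2 * rho j) / rho j := by
    rw [le_div_iff₀ (rho_pos j)]; linarith
  simp [chi, this]

lemma chi_off (Ω : Set (Euc N)) (j : ℕ) (x y : Euc N) (h : x ∉ Ω) (hy : ‖y - x‖ ≤ rho j) :
    chi Ω j y = 0 := by
  apply chi_zero
  have h1 : infDist y Ωᶜ ≤ dist y x := infDist_le_dist_of_mem h
  rw [dist_eq_norm] at h1
  linarith [rho_pos j]

lemma chi_supp {Ω : Set (Euc N)} (hb : Bornology.IsBounded Ω) (j : ℕ) :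
    HasCompactSupport (chi Ω j) := by
  refine HasCompactSupport.intro hb.isCompact_closure fun x hx => ?_
  refine chi_off Ω j x x (fun h => hx (subset_closure h)) ?_
  simpa using (rho_pos j).le

/-- right-hand side -/
def rhs (F : Bool → Euc N → ℝ) (L : Bool → ℝ) (w : Bool → Euc N → ℝ) (i : Bool) (x : Euc N) : ℝ :=
  L i * F i x / (1 - w (!i) x) ^ 2

section
variable {F : Bool → Euc N → ℝ} {L : Bool → ℝ}

lemma rhs_nonneg (hF0 : ∀ i x, 0 ≤ F i x) (hL : ∀ i, 0 ≤ L i)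
    (w : Bool → Euc N → ℝ) (i : Bool) (x : Euc N) : 0 ≤ rhs F L w i x :=
  div_nonneg (mul_nonneg (hL i) (hF0 i x)) (sq_nonneg _)

lemma rhs_mono (hF0 : ∀ i x, 0 ≤ F i x) (hL : ∀ i, 0 ≤ L i)
    {w w' : Bool → Euc N → ℝ} {i : Bool} {x : Euc N} (h : w (!i) x ≤ w' (!i) x)
    (h' : w' (!i) x < 1) : rhs F L w i x ≤ rhs F L w' i x := by
  unfold rhs
  have h1 : 0 < 1 - w' (!i) x := by linarith
  have h2 : 1 - w' (!i) x ≤ 1 - w (!i) x := by linarith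
  have := mul_nonneg (hL i) (hF0 i x)
  gcongr

lemma rhs_bdd (hF0 : ∀ i x, 0 ≤ F i x) (hF1 : ∀ i x, F i x ≤ 1) (hL : ∀ i, 0 ≤ L i)
    {M : ℝ} (hM : M < 1) {w : Bool → Euc N → ℝ} {i : Bool} {x : Euc N}
    (h : w (!i) x ≤ M) : |rhs F L w i x| ≤ L i / (1 - M) ^ 2 := by
  rw [abs_of_nonneg (rhs_nonneg hF0 hL w i x)]
  unfold rhs
  have h1 : 0 < 1 - M := by linarith
  have h2 : 1 - M ≤ 1 - w (!i) x := by linarith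
  have h3 : L i * F i x ≤ L i := mul_le_of_le_one_right (hL i) (hF1 i x)
  have := hL i
  gcongr

end

lemma rhs_cont {F : Bool → Euc N → ℝ} (L : Bool → ℝ) (hF : ∀ i, Continuous (F i))
    {w : Bool → Euc N → ℝ} (hw : ∀ i, Continuous (w i)) (h1 : ∀ i x, w i x < 1) (i : Bool) :
    Continuous (rhs F L w i) := by
  unfold rhs
  have := hF i
  have := hw (!i)
  refine Continuous.div (by fun_prop) (by fun_prop) fun x => ?_
  have := h1 (!i) x
  have : 0 < 1 - w (!i) x := by linarith
  positivity

/-- correction density -/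
def cor (Ω : Set (Euc N)) (F : Bool → Euc N → ℝ) (L : Bool → ℝ) (j : ℕ) (w a : Bool → Euc N → ℝ)
    (i : Bool) (x : Euc N) : ℝ := chi Ω j x * (a i x - rhs F L w i x)

/-- one step of the scheme -/
def stp (k : Ker N) (Ω : Set (Euc N)) (F : Bool → Euc N → ℝ) (L : Bool → ℝ) (j : ℕ)
    (p : (Bool → Euc N → ℝ) × (Bool → Euc N → ℝ)) :
    (Bool → Euc N → ℝ) × (Bool → Euc N → ℝ) :=
  (fun i x => p.1 i x - avg (k.K (rho j)) (cor Ω F L j p.1 p.2 i) x,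
   fun i x => p.2 i x - cor Ω F L j p.1 p.2 i x + avg (k.P (rho j)) (cor Ω F L j p.1 p.2 i) x)

/-- invariants -/
structure PInv (k : Ker N) (Ω : Set (Euc N)) (F : Bool → Euc N → ℝ) (L : Bool → ℝ)
    (U : Bool → Euc N → ℝ) (w a : Bool → Euc N → ℝ) : Prop where
  wc : ∀ i, Continuous (w i)
  w0 : ∀ i x, x ∉ Ω → w i x = 0
  wnn : ∀ i x, 0 ≤ w i x
  wU : ∀ i x, w i x ≤ U i x
  ac : ∀ i, Continuous (a i)
  ab : ∀ i, ∃ C, ∀ x, |a i x| ≤ C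
  ah : ∀ i x, rhs F L w i x ≤ a i x
  rep : ∀ i j x, closedBall x (2 * rho j) ⊆ Ω →
    w i x = avg (k.P (rho j)) (w i) x + avg (k.K (rho j)) (a i) x

section
variable {k : Ker N} {Ω : Set (Euc N)} {F : Bool → Euc N → ℝ} {L : Bool → ℝ}
    {U : Bool → Euc N → ℝ} {w a : Bool → Euc N → ℝ}

lemma bdd_of_supp (hb : Bornology.IsBounded Ω) {w : Euc N → ℝ} (hw : Continuous w)
    (h0 : ∀ x, x ∉ Ω → w x = 0) : ∃ C, ∀ x, |w x| ≤ C :=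
  hw.bounded_above_of_compact_support
    (HasCompactSupport.intro hb.isCompact_closure fun x hx => h0 x fun h => hx (subset_closure h))

lemma cor_facts (hF : ∀ i, Continuous (F i)) (hU : ∀ i x, U i x < 1)
    (hb : Bornology.IsBounded Ω) (I : PInv k Ω F L U w a) (j : ℕ) (i : Bool) :
    Continuous (cor Ω F L j w a i) ∧ HasCompactSupport (cor Ω F L j w a i) ∧
    (∀ x, 0 ≤ cor Ω F L j w a i x) ∧ (∀ x, cor Ω F L j w a i x ≤ a i x - rhs F L w i x) := by
  have h1 := rhs_cont L hF I.wc (fun i x => (I.wU i x).trans_lt (hU i x)) i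
  have h2 := I.ac i
  have h3 := chi_cont Ω j
  refine ⟨h3.mul (h2.sub h1), (chi_supp hb j).mul_right, fun x => ?_, fun x => ?_⟩
  · exact mul_nonneg (chi_nonneg _ _ _) (sub_nonneg.2 (I.ah i x))
  · exact mul_le_of_le_one_left (sub_nonneg.2 (I.ah i x)) (chi_le _ _ _)

lemma PInv.step (hN : 0 < N) (hF : ∀ i, Continuous (F i)) (hF0 : ∀ i x, 0 ≤ F i x)
    (hL : ∀ i, 0 ≤ L i) (hU : ∀ i x, U i x < 1) (ho : IsOpen Ω)
    (hb : Bornology.IsBounded Ω) (I : PInv k Ω F L U w a) (j : ℕ) :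
    PInv k Ω F L U (stp k Ω F L j (w, a)).1 (stp k Ω F L j (w, a)).2 := by
  have hcor := cor_facts hF hU hb I j
  have hcb : ∀ i, ∃ C, ∀ x, |cor Ω F L j w a i x| ≤ C := fun i =>
    (hcor i).1.bounded_above_of_compact_support (hcor i).2.1
  have hKc : ∀ i, Continuous (avg (k.K (rho j)) (cor Ω F L j w a i)) := fun i => by
    obtain ⟨C, hC⟩ := hcb i
    exact avg_continuous (hcor i).1 hC
  have hPc : ∀ i, Continuous (avg (k.P (rho j)) (cor Ω F L j w a i)) := fun i => by
    obtain ⟨C, hC⟩ := hcb i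
    exact avg_continuous (hcor i).1 hC
  have hKn : ∀ i x, 0 ≤ avg (k.K (rho j)) (cor Ω F L j w a i) x := fun i x =>
    avg_nonneg (hcor i).2.2.1 x
  have hPn : ∀ i x, 0 ≤ avg (k.P (rho j)) (cor Ω F L j w a i) x := fun i x =>
    avg_nonneg (hcor i).2.2.1 x
  have wc : ∀ i, Continuous ((stp k Ω F L j (w, a)).1 i) := fun i => (I.wc i).sub (hKc i)
  have ac : ∀ i, Continuous ((stp k Ω F L j (w, a)).2 i) := fun i =>
    ((I.ac i).sub (hcor i).1).add (hPc i)
  have w0 : ∀ i x, x ∉ Ω → (stp k Ω F L j (w, a)).1 i x = 0 := by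
    intro i x hx
    have : avg (k.K (rho j)) (cor Ω F L j w a i) x = avg (k.K (rho j)) (fun _ => 0) x := by
      refine avg_congr (k.K_supp _) fun y hy => ?_
      rw [mem_closedBall, dist_eq_norm] at hy
      simp [cor, chi_off Ω j x y hx hy]
    simp only [stp, this, I.w0 i x hx]
    simp [avg]
  have wle : ∀ i x, (stp k Ω F L j (w, a)).1 i x ≤ w i x := fun i x => sub_le_self _ (hKn i x)
  have ah : ∀ i x, rhs F L (stp k Ω F L j (w, a)).1 i x ≤ (stp k Ω F L j (w, a)).2 i x := by
    intro i x
    have h1 := rhs_mono (i := i) hF0 hL (wle (!i) x) ((I.wU _ x).trans_lt (hU _ x))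
    have h2 := (hcor i).2.2.2 x
    have h3 := hPn i x
    simp only [stp] at h1 ⊢
    linarith
  have ab : ∀ i, ∃ C, ∀ x, |(stp k Ω F L j (w, a)).2 i x| ≤ C := by
    intro i
    obtain ⟨A, hA⟩ := I.ab i
    obtain ⟨C, hC⟩ := hcb i
    refine ⟨A + C + C * (k.P (rho j)).real univ, fun x => ?_⟩
    have := avg_abs_le (m := k.P (rho j)) hC x
    exact (abs_add_le _ _).trans (add_le_add ((abs_sub _ _).trans (add_le_add (hA x) (hC x))) this)
  have rep : ∀ i j' x, closedBall x (2 * rho j') ⊆ Ω → (stp k Ω F L j (w, a)).1 i x =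
      avg (k.P (rho j')) ((stp k Ω F L j (w, a)).1 i) x +
      avg (k.K (rho j')) ((stp k Ω F L j (w, a)).2 i) x := by
    intro i j' x hx
    obtain ⟨A, hA⟩ := I.ab i
    obtain ⟨C, hC⟩ := hcb i
    obtain ⟨B, hB⟩ := bdd_of_supp hb (I.wc i) (I.w0 i)
    have e1 := k.comm_cont (hcor i).1 (hcor i).2.1 (rho_pos j) (rho_pos j') x
    have e2 := avg_sub (m := k.P (rho j')) (I.wc i).measurable hB (hKc i).measurable
      (avg_abs_le hC) x
    have e3 := avg_sub (m := k.K (rho j')) (I.ac i).measurable hA (hcor i).1.measurable hC x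
    have e4 := avg_add (m := k.K (rho j')) ((I.ac i).sub (hcor i).1).measurable
      (fun x => (abs_sub _ _).trans (add_le_add (hA x) (hC x))) (hPc i).measurable
      (avg_abs_le hC) x
    have e5 := I.rep i j' x hx
    simp only [stp]
    simp only [Pi.sub_apply] at e4
    have e3' : avg (k.K (rho j')) (a i - cor Ω F L j w a i) x = _ := e3
    rw [e2, e4, e3']
    linarith
  refine ⟨wc, w0, ?_, fun i x => (wle i x).trans (I.wU i x), ac, ab, ah, rep⟩
  intro i
  refine min_principle hN k hb (wc i) (w0 i) ?_
  intro x hx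
  obtain ⟨j', hj'⟩ := exists_rho ho hx 2
  refine ⟨rho j', rho_pos j', (closedBall_subset_closedBall ?_).trans hj', ?_⟩
  · linarith [rho_pos j']
  · have h1 := rep i j' x hj'
    have h2 : 0 ≤ avg (k.K (rho j')) ((stp k Ω F L j (w, a)).2 i) x :=
      avg_nonneg (fun y => (rhs_nonneg hF0 hL _ i y).trans (ah i y)) x
    linarith

end
end ex


section lim
variable {N : ℕ}

/-- the iteration -/
def itr (k : Ker N) (Ω : Set (Euc N)) (F : Bool → Euc N → ℝ) (L : Bool → ℝ)
    (p : (Bool → Euc N → ℝ) × (Bool → Euc N → ℝ)) :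
    ℕ → (Bool → Euc N → ℝ) × (Bool → Euc N → ℝ)
  | 0 => p
  | n + 1 => stp k Ω F L (Nat.unpair n).1 (itr k Ω F L p n)

lemma avg_tendsto {m : Measure (Euc N)} [IsFiniteMeasure m] {w : ℕ → Euc N → ℝ} {v : Euc N → ℝ}
    {C : ℝ} (hw : ∀ n, Measurable (w n)) (hC : ∀ n x, |w n x| ≤ C)
    (h : ∀ x, Tendsto (fun n => w n x) atTop (𝓝 (v x))) (x : Euc N) :
    Tendsto (fun n => avg m (w n) x) atTop (𝓝 (avg m v x)) := by
  unfold avg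
  refine tendsto_integral_of_dominated_convergence (fun _ => C) (fun n => ?_)
    (integrable_const _) (fun n => Eventually.of_forall fun z => hC n _)
    (Eventually.of_forall fun z => h _)
  have := hw n
  exact Measurable.aestronglyMeasurable (by fun_prop)

theorem exists_limit (hN : 0 < N) (k : Ker N) {Ω : Set (Euc N)} (ho : IsOpen Ω)
    (hb : Bornology.IsBounded Ω) (hne : Ωᶜ.Nonempty) {F : Bool → Euc N → ℝ} {L : Bool → ℝ}
    (hF : ∀ i, Continuous (F i)) (hF0 : ∀ i x, 0 ≤ F i x) (hF1 : ∀ i x, F i x ≤ 1)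
    (hL : ∀ i, 0 ≤ L i) {U A : Bool → Euc N → ℝ} {M : ℝ} (hM : M < 1) (hU : ∀ i x, U i x ≤ M)
    (I0 : PInv k Ω F L U U A) :
    ∃ w : Bool → Euc N → ℝ, (∀ i, Measurable (w i)) ∧ (∀ i x, 0 ≤ w i x) ∧
      (∀ i x, w i x ≤ U i x) ∧ ∀ i j x, closedBall x (4 * rho j) ⊆ Ω →
        w i x = avg (k.P (rho j)) (w i) x + avg (k.K (rho j)) (rhs F L w i) x := by
  set p := itr k Ω F L (U, A) with hp
  have hU1 : ∀ i x, U i x < 1 := fun i x => (hU i x).trans_lt hM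
  have I : ∀ n, PInv k Ω F L U (p n).1 (p n).2 := by
    intro n
    induction n with
    | zero => exact I0
    | succ n ih => exact ih.step hN hF hF0 hL hU1 ho hb (Nat.unpair n).1
  have hstep : ∀ n i x, (p (n+1)).1 i x = (p n).1 i x - avg (k.K (rho (Nat.unpair n).1))
      (cor Ω F L (Nat.unpair n).1 (p n).1 (p n).2 i) x := fun n i x => rfl
  have hanti : ∀ i x, Antitone (fun n => (p n).1 i x) := by
    intro i x
    refine antitone_nat_of_succ_le fun n => ?_
    rw [hstep]
    exact sub_le_self _ (avg_nonneg (cor_facts hF hU1 hb (I n) _ i).2.2.1 x)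
  have hlim : ∀ i x, Tendsto (fun n => (p n).1 i x) atTop (𝓝 (⨅ n, (p n).1 i x)) := fun i x =>
    tendsto_atTop_ciInf (hanti i x) ⟨0, by rintro _ ⟨n, rfl⟩; exact (I n).wnn i x⟩
  set w : Bool → Euc N → ℝ := fun i x => ⨅ n, (p n).1 i x with hw
  have hw0 : ∀ i x, 0 ≤ w i x := fun i x => ge_of_tendsto' (hlim i x) fun n => (I n).wnn i x
  have hwU : ∀ i x, w i x ≤ U i x := fun i x => le_of_tendsto' (hlim i x) fun n => (I n).wU i x
  refine ⟨w, ?_, hw0, hwU, ?_⟩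
  · intro i
    exact measurable_of_tendsto_metrizable (fun n => ((I n).wc i).measurable)
      (tendsto_pi_nhds.2 (hlim i))
  · intro i j x hx
    set φ : ℕ → ℕ := fun m => Nat.pair j m with hφ
    have hφt : Tendsto φ atTop atTop := tendsto_atTop_mono (fun m => Nat.right_le_pair j m) tendsto_id
    have hφ1 : ∀ m, (Nat.unpair (φ m)).1 = j := by intro m; simp [hφ]
    have hr := rho_pos j
    have key : ∀ m, (p (φ m)).1 i x = avg (k.P (rho j)) ((p (φ m)).1 i) x +
        (avg (k.K (rho j)) (rhs F L (p (φ m)).1 i) x + ((p (φ m)).1 i x - (p (φ m + 1)).1 i x)) := by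
      intro m
      have J := I (φ m)
      have h1 := J.rep i j x ((closedBall_subset_closedBall (by linarith)).trans hx)
      have h2 := hstep (φ m) i x
      rw [hφ1] at h2
      have hrb : ∀ x, |rhs F L (p (φ m)).1 i x| ≤ L i / (1 - M) ^ 2 := fun x =>
        rhs_bdd hF0 hF1 hL hM ((J.wU _ x).trans (hU _ x))
      have hrc := rhs_cont L hF J.wc (fun i x => (J.wU i x).trans_lt (hU1 i x)) i
      obtain ⟨B, hB⟩ := J.ab i
      have h3 : avg (k.K (rho j)) (cor Ω F L j (p (φ m)).1 (p (φ m)).2 i) x =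
          avg (k.K (rho j)) (fun y => (p (φ m)).2 i y - rhs F L (p (φ m)).1 i y) x := by
        refine avg_congr (k.K_supp _) fun y hy => ?_
        have : chi Ω j y = 1 := by
          apply chi_one
          rw [le_infDist hne]
          intro z hz
          by_contra! hlt
          apply hz
          apply hx
          rw [mem_closedBall] at hy ⊢
          have := dist_triangle z y x
          rw [dist_comm] at hlt
          linarith
        simp [cor, this]
      rw [avg_sub (J.ac i).measurable hB hrc.measurable hrb] at h3
      linarith
    have t1 := (hlim i x).comp hφt
    have t2 : Tendsto (fun m => (p (φ m + 1)).1 i x) atTop (𝓝 (w i x)) :=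
      (hlim i x).comp ((tendsto_add_atTop_nat 1).comp hφt)
    have t3 : Tendsto (fun m => avg (k.P (rho j)) ((p (φ m)).1 i) x) atTop
        (𝓝 (avg (k.P (rho j)) (w i) x)) := by
      refine avg_tendsto (C := 1) (fun m => ((I _).wc i).measurable) (fun m x => ?_)
        (fun x => (hlim i x).comp hφt) x
      rw [abs_of_nonneg ((I _).wnn i x)]
      exact ((I _).wU i x).trans (hU1 i x).le
    have t4 : Tendsto (fun m => avg (k.K (rho j)) (rhs F L (p (φ m)).1 i) x) atTop
        (𝓝 (avg (k.K (rho j)) (rhs F L w i) x)) := by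
      refine avg_tendsto (C := L i / (1 - M) ^ 2) (fun m => ?_) (fun m x => ?_) (fun y => ?_) x
      · exact (rhs_cont L hF (I _).wc (fun i x => ((I _).wU i x).trans_lt (hU1 i x)) i).measurable
      · exact rhs_bdd hF0 hF1 hL hM (((I _).wU _ x).trans (hU _ x))
      · unfold rhs
        have hpos : 0 < 1 - w (!i) y := by linarith [hwU (!i) y, hU1 (!i) y]
        refine Tendsto.div tendsto_const_nhds ?_ (by positivity)
        exact (tendsto_const_nhds.sub ((hlim (!i) y).comp hφt)).pow 2
    have t5 := t3.add (t4.add (t1.sub t2))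
    have t6 := tendsto_nhds_unique t1 (t5.congr fun m => (key m).symm)
    have : w i x = ⨅ n, (p n).1 i x := rfl
    rw [← this] at t6
    linarith

end lim


section fin
variable {N : ℕ}

structure LimD (k : Ker N) (Ω : Set (Euc N)) (F : Bool → Euc N → ℝ) (L : Bool → ℝ) (M : ℝ)
    (w : Bool → Euc N → ℝ) : Prop where
  ho : IsOpen Ω
  hb : Bornology.IsBounded Ω
  hF : ∀ i, Continuous (F i)
  hF0 : ∀ i x, 0 ≤ F i x
  hF1 : ∀ i x, F i x ≤ 1
  hL : ∀ i, 0 ≤ L i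
  hM : M < 1
  wm : ∀ i, Measurable (w i)
  w0 : ∀ i x, x ∉ Ω → w i x = 0
  wnn : ∀ i x, 0 ≤ w i x
  wM : ∀ i x, w i x ≤ M
  rep : ∀ i j x, closedBall x (4 * rho j) ⊆ Ω →
        w i x = avg (k.P (rho j)) (w i) x + avg (k.K (rho j)) (rhs F L w i) x

lemma integrable_bs {Ω : Set (Euc N)} (hb : Bornology.IsBounded Ω) {h : Euc N → ℝ}
    (hm : Measurable h) {C : ℝ} (hC : ∀ x, |h x| ≤ C) (h0 : ∀ x, x ∉ Ω → h x = 0) :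
    Integrable h := by
  have hfin : volume (closure Ω) < ⊤ := hb.isCompact_closure.measure_lt_top
  have h1 : IntegrableOn h (closure Ω) :=
    IntegrableOn.of_bound hfin hm.aestronglyMeasurable C (Eventually.of_forall hC)
  exact h1.integrable_of_forall_notMem_eq_zero fun x hx => h0 x fun h => hx (subset_closure h)

variable {k : Ker N} {Ω : Set (Euc N)} {F : Bool → Euc N → ℝ} {L : Bool → ℝ} {M : ℝ}
    {w : Bool → Euc N → ℝ}

lemma LimD.wabs (D : LimD k Ω F L M w) (i : Bool) (x : Euc N) : |w i x| ≤ 1 := by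
  rw [abs_of_nonneg (D.wnn i x)]; exact (D.wM i x).trans D.hM.le

lemma LimD.wint (D : LimD k Ω F L M w) (i : Bool) : Integrable (w i) :=
  integrable_bs D.hb (D.wm i) (D.wabs i) (D.w0 i)

lemma LimD.hm (D : LimD k Ω F L M w) (i : Bool) : Measurable (Ω.indicator (rhs F L w i)) := by
  refine Measurable.indicator ?_ D.ho.measurableSet
  unfold rhs
  have := D.wm (!i)
  have := (D.hF i).measurable
  fun_prop

lemma LimD.hbd (D : LimD k Ω F L M w) (i : Bool) (x : Euc N) :
    |Ω.indicator (rhs F L w i) x| ≤ L i / (1 - M) ^ 2 := by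
  by_cases hx : x ∈ Ω
  · rw [indicator_of_mem hx]
    exact rhs_bdd D.hF0 D.hF1 D.hL D.hM (D.wM _ x)
  · rw [indicator_of_notMem hx, abs_zero]
    exact div_nonneg (D.hL i) (sq_nonneg _)

lemma LimD.hint (D : LimD k Ω F L M w) (i : Bool) : Integrable (Ω.indicator (rhs F L w i)) :=
  integrable_bs D.hb (D.hm i) (D.hbd i) fun _ hx => indicator_of_notMem hx _

lemma LimD.rep' (D : LimD k Ω F L M w) (i : Bool) (j : ℕ) (x : Euc N)
    (hx : closedBall x (4 * rho j) ⊆ Ω) :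
    w i x = avg (k.P (rho j)) (w i) x + avg (k.K (rho j)) (Ω.indicator (rhs F L w i)) x := by
  rw [D.rep i j x hx]
  congr 1
  refine avg_congr (k.K_supp _) fun y hy => ?_
  rw [indicator_of_mem]
  exact hx (closedBall_subset_closedBall (by linarith [rho_pos j]) hy)

lemma LimD.lip (D : LimD k Ω F L M w) {x0 : Euc N} {j : ℕ} (hj : closedBall x0 (5 * rho j) ⊆ Ω)
    (i : Bool) : ∃ C, 0 ≤ C ∧ ∀ x ∈ closedBall x0 (rho j), ∀ y ∈ closedBall x0 (rho j),
      |w i x - w i y| ≤ C * ‖x - y‖ := by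
  obtain ⟨C1, h1⟩ := k.P_lip (D.wm i) (D.wint i) (D.wabs i) (rho_pos j)
  obtain ⟨C2, h2⟩ := k.K_lip (D.hm i) (D.hint i) (D.hbd i) (rho j)
  have hsub : ∀ x ∈ closedBall x0 (rho j), closedBall x (4 * rho j) ⊆ Ω := by
    intro x hx
    refine Subset.trans (closedBall_subset_closedBall' ?_) hj
    rw [mem_closedBall] at hx
    linarith
  refine ⟨|C1| + |C2|, by positivity, fun x hx y hy => ?_⟩
  rw [D.rep' i j x (hsub x hx), D.rep' i j y (hsub y hy)]
  have e1 := h1 x y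
  have e2 := h2 x y
  have e3 : C1 * ‖x - y‖ ≤ |C1| * ‖x - y‖ := by gcongr; exact le_abs_self _
  have e4 : C2 * ‖x - y‖ ≤ |C2| * ‖x - y‖ := by gcongr; exact le_abs_self _
  rw [add_sub_add_comm, add_mul]
  exact (abs_add_le _ _).trans (by linarith)

lemma inv_sq_lip {M a b : ℝ} (hM : M < 1) (ha : a ≤ M) (hb : b ≤ M) (ha0 : 0 ≤ a) (hb0 : 0 ≤ b) :
    |1 / (1 - a) ^ 2 - 1 / (1 - b) ^ 2| ≤ 2 / (1 - M) ^ 4 * |a - b| := by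
  have h1 : 0 < 1 - M := by linarith
  have h2 : 1 - M ≤ 1 - a := by linarith
  have h3 : 1 - M ≤ 1 - b := by linarith
  have h4 : 0 < 1 - a := by linarith
  have h5 : 0 < 1 - b := by linarith
  have e : 1 / (1 - a) ^ 2 - 1 / (1 - b) ^ 2 = ((2 - a - b) / ((1 - a) ^ 2 * (1 - b) ^ 2)) * (a - b) := by
    field_simp; ring
  rw [e, abs_mul]
  refine mul_le_mul_of_nonneg_right ?_ (abs_nonneg _)
  rw [abs_of_nonneg (div_nonneg (by linarith) (by positivity))]
  have h6 : (1 - M) ^ 4 ≤ (1 - a) ^ 2 * (1 - b) ^ 2 := by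
    calc (1 - M) ^ 4 = (1 - M) ^ 2 * (1 - M) ^ 2 := by ring
      _ ≤ _ := by gcongr
  have h7 : 2 - a - b ≤ 2 := by linarith
  gcongr

lemma LimD.hol (D : LimD k Ω F L M w) {x0 : Euc N} {j : ℕ} (hj : closedBall x0 (5 * rho j) ⊆ Ω)
    (i : Bool) {α Cf : ℝ} (hα0 : 0 < α) (hα : α ≤ 1) (hCf : 0 ≤ Cf)
    (hf : ∀ x ∈ Ω, ∀ y ∈ Ω, |F i x - F i y| ≤ Cf * ‖x - y‖ ^ α) :
    ∃ C, 0 ≤ C ∧ ∀ x ∈ closedBall x0 (rho j), ∀ y ∈ closedBall x0 (rho j), ‖x - y‖ ≤ 1 →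
      |Ω.indicator (rhs F L w i) x - Ω.indicator (rhs F L w i) y| ≤ C * ‖x - y‖ ^ α := by
  obtain ⟨C, hC0, hC⟩ := D.lip hj (!i)
  have hpos := rho_pos j
  have hsub : closedBall x0 (rho j) ⊆ Ω :=
    (closedBall_subset_closedBall (by linarith)).trans hj
  have hM1 : 0 < 1 - M := by linarith [D.hM]
  have hLi := D.hL i
  refine ⟨L i * Cf * (1 / (1 - M) ^ 2) + L i * (2 / (1 - M) ^ 4 * C), by positivity,
    fun x hx y hy hxy => ?_⟩
  rw [indicator_of_mem (hsub hx), indicator_of_mem (hsub hy)]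
  have h1 := hf x (hsub hx) y (hsub hy)
  have h2 := inv_sq_lip D.hM (D.wM (!i) x) (D.wM (!i) y) (D.wnn (!i) x) (D.wnn (!i) y)
  have h3 := hC x hx y hy
  have h4 : ‖x - y‖ ≤ ‖x - y‖ ^ α := by
    simpa using Real.rpow_le_rpow_of_exponent_ge' (norm_nonneg _) hxy hα0.le hα
  have h5 : |1 / (1 - w (!i) x) ^ 2| ≤ 1 / (1 - M) ^ 2 := by
    rw [abs_of_nonneg (by positivity)]
    have : 1 - M ≤ 1 - w (!i) x := by linarith [D.wM (!i) x]
    gcongr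
  have e : rhs F L w i x - rhs F L w i y = L i * (F i x - F i y) * (1 / (1 - w (!i) x) ^ 2) +
      L i * F i y * (1 / (1 - w (!i) x) ^ 2 - 1 / (1 - w (!i) y) ^ 2) := by
    unfold rhs; ring
  have h6 : |F i y| ≤ 1 := by rw [abs_of_nonneg (D.hF0 i y)]; exact D.hF1 i y
  rw [e, add_mul]
  refine (abs_add_le _ _).trans (add_le_add ?_ ?_)
  · rw [abs_mul, abs_mul, abs_of_nonneg hLi]
    calc _ ≤ L i * (Cf * ‖x - y‖ ^ α) * (1 / (1 - M) ^ 2) := by gcongr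
      _ = _ := by ring
  · rw [abs_mul, abs_mul, abs_of_nonneg hLi]
    calc _ ≤ L i * 1 * (2 / (1 - M) ^ 4 * (C * ‖x - y‖ ^ α)) := by
          gcongr
          refine h2.trans ?_
          gcongr
          refine h3.trans ?_
          gcongr
      _ = _ := by ring

lemma LimD.c2 (D : LimD k Ω F L M w)
    (i : Bool) {α Cf : ℝ} (hα0 : 0 < α) (hα : α ≤ 1) (hCf : 0 ≤ Cf)
    (hf : ∀ x ∈ Ω, ∀ y ∈ Ω, |F i x - F i y| ≤ Cf * ‖x - y‖ ^ α) : ContDiffOn ℝ 2 (w i) Ω := by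
  intro x0 hx0
  apply ContDiffAt.contDiffWithinAt
  obtain ⟨j, hj⟩ := exists_rho D.ho hx0 5
  obtain ⟨C, hC0, hC⟩ := D.hol hj i hα0 hα hCf hf
  obtain ⟨j', hj1⟩ := ((rho_tendsto.const_mul 5).eventually (gt_mem_nhds
    (show 5 * 0 < rho j by simpa using rho_pos j))).exists
  have hp := rho_pos j
  have hp' := rho_pos j'
  have hr1 : rho j' ≤ 1 := by
    unfold rho
    rw [div_le_one (by positivity)]
    linarith [Nat.cast_nonneg (α := ℝ) j']
  have h1 : ContDiffOn ℝ 2 (avg (k.K (rho j')) (Ω.indicator (rhs F L w i))) (ball x0 (rho j')) := by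
    refine k.K_c2 (D.hm i) (D.hint i) (D.hbd i) isOpen_ball hα0 (C := C) ?_ hC0
    intro x hx z hz
    rw [mem_ball] at hx
    have := hC (x + z) ?_ x ?_ ?_
    · simpa using this
    · rw [mem_closedBall]
      have h2 : dist (x + z) x = ‖z‖ := by simp
      have := dist_triangle (x + z) x x0
      linarith
    · rw [mem_closedBall]; linarith
    · simpa using hz.trans hr1
  have h2 := k.P_c2 (D.wm i) (D.wint i) hp'
  have h3 : ContDiffOn ℝ 2 (w i) (ball x0 (rho j')) := by
    refine (h2.contDiffOn.add h1).congr fun x hx => ?_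
    refine D.rep' i j' x ?_
    rw [mem_ball] at hx
    exact Subset.trans (closedBall_subset_closedBall' (by linarith)) hj
  exact h3.contDiffAt (ball_mem_nhds _ hp')

lemma Ker.K_zero (k : Ker N) {d : Euc N → ℝ} (hd : Measurable d) {C : ℝ} (hC : ∀ x, |d x| ≤ C)
    {x : Euc N} (hc : ContinuousAt d x) (h : ∀ᶠ j in atTop, avg (k.K (rho j)) d x = 0) :
    d x = 0 := by
  have key : ∀ ε > 0, |d x| ≤ ε := by
    intro ε hε
    obtain ⟨δ, hδ, hd'⟩ := Metric.continuousAt_iff.1 hc ε hε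
    obtain ⟨j, hj, hj2⟩ := (h.and (rho_tendsto.eventually (gt_mem_nhds hδ))).exists
    have hm := k.K_mass (rho_pos j)
    have e := avg_sub (m := k.K (rho j)) (w := fun _ => d x) (C := |d x|) measurable_const
      (fun _ => le_rfl) hd hC x
    rw [hj, sub_zero] at e
    have e2 : avg (k.K (rho j)) (fun _ => d x) x = (k.K (rho j)).real univ * d x := by
      simp [avg]
    have e3 : |avg (k.K (rho j)) (fun y => d x - d y) x| ≤ ε * (k.K (rho j)).real univ := by
      refine norm_integral_le_of_norm_le_const (μ := k.K (rho j)) (f := fun z => d x - d (x + z))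
        (C := ε) ?_
      filter_upwards [k.K_supp (rho j)] with z hz
      have : dist (x + z) x < δ := by simpa using hz.trans_lt hj2
      have := hd' this
      rw [Real.dist_eq, abs_sub_comm] at this
      exact this.le
    rw [e, e2, abs_mul, abs_of_pos hm] at e3
    nlinarith
  have : |d x| ≤ 0 := le_of_forall_pos_le_add fun ε hε => by simpa using key ε hε
  exact abs_nonpos_iff.1 this

lemma LimD.eqn (D : LimD k Ω F L M w) (hc2 : ∀ i, ContDiffOn ℝ 2 (w i) Ω) (i : Bool) {x : Euc N}
    (hx : x ∈ Ω) : -lap (w i) x = rhs F L w i x := by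
  obtain ⟨j0, hj0⟩ := exists_rho D.ho hx 4
  have hp0 := rho_pos j0
  obtain ⟨W, hW, hWs, hWe⟩ := exists_cutoff D.ho (hc2 i) (x := x) hp0
    ((closedBall_subset_closedBall (by linarith)).trans hj0)
  obtain ⟨B, hB⟩ := (lap_continuous hW).bounded_above_of_compact_support
    (f := lap W) (by
      refine HasCompactSupport.intro hWs fun y hy => ?_
      have : W =ᶠ[𝓝 y] (fun _ => 0) := notMem_tsupport_iff_eventuallyEq.1 hy
      rw [lap_congr this]
      simp [lap, secondDerivCoord])
  have hnx : Ω ∈ 𝓝 x := D.ho.mem_nhds hx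
  have hrc : ContinuousAt (Ω.indicator (rhs F L w i)) x := by
    have h1 : ContinuousAt (rhs F L w i) x := by
      unfold rhs
      have h1 := (hc2 (!i)).continuousOn.continuousAt hnx
      have h2 := (D.hF i).continuousAt (x := x)
      have h3 : 0 < 1 - w (!i) x := by linarith [D.wM (!i) x, D.hM]
      exact (continuousAt_const.mul h2).div ((continuousAt_const.sub h1).pow 2) (by positivity)
    refine h1.congr ?_
    filter_upwards [hnx] with y hy
    rw [indicator_of_mem hy]
  have hW0 : W =ᶠ[𝓝 x] w i := hWe x (mem_closedBall_self hp0.le)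
  have hz := k.K_zero (d := fun y => lap W y + Ω.indicator (rhs F L w i) y) (x := x)
    (C := B + L i / (1 - M) ^ 2)
    ((lap_continuous hW).measurable.add (D.hm i))
    (fun y => (abs_add_le _ _).trans (add_le_add (hB y) (D.hbd i y)))
    ((lap_continuous hW).continuousAt.add hrc) ?_
  · rw [lap_congr hW0, indicator_of_mem hx] at hz
    linarith
  · filter_upwards [rho_tendsto.eventually (gt_mem_nhds hp0)] with j hj
    have e1 := k.c2_id hW hWs (rho_pos j) x
    have e2 := D.rep' i j x ((closedBall_subset_closedBall (by linarith)).trans hj0)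
    have e3 : avg (k.P (rho j)) W x = avg (k.P (rho j)) (w i) x :=
      avg_congr (k.P_supp (rho_pos j).le) fun y hy =>
        (hWe y (closedBall_subset_closedBall hj.le hy)).eq_of_nhds
    rw [avg_add (lap_continuous hW).measurable hB (D.hm i) (D.hbd i)]
    have e4 := hW0.eq_of_nhds
    linarith

end fin


lemma ext_cont {N : ℕ} {Ω : Set (Euc N)} {f : Euc N → ℝ} (h : HypH Ω f) :
    ∃ F : Euc N → ℝ, Continuous F ∧ (∀ x, 0 ≤ F x) ∧ (∀ x, F x ≤ 1) ∧
      ∀ x ∈ closure Ω, F x = f x := by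
  obtain ⟨⟨α, hα, -, C, hC⟩, h01, -⟩ := h
  have hc := hC.continuousOn hα
  obtain ⟨G, hG⟩ := ContinuousMap.exists_restrict_eq (isClosed_closure (s := Ω))
    ⟨(closure Ω).domRestrict f, hc.domRestrict⟩
  refine ⟨fun x => max 0 (min 1 (G x)), by fun_prop, fun x => le_max_left _ _,
    fun x => max_le zero_le_one (min_le_left _ _), fun x hx => ?_⟩
  have e : G x = f x := by
    have := congrArg (fun g => g ⟨x, hx⟩) hG
    exact this
  simp only [e]
  rw [min_eq_right (h01 x hx).2, max_eq_right (h01 x hx).1]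

lemma hyp_holder {N : ℕ} {Ω : Set (Euc N)} {f : Euc N → ℝ} (h : HypH Ω f) :
    ∃ α Cf : ℝ, 0 < α ∧ α ≤ 1 ∧ 0 ≤ Cf ∧
      ∀ x ∈ closure Ω, ∀ y ∈ closure Ω, |f x - f y| ≤ Cf * ‖x - y‖ ^ α := by
  obtain ⟨⟨α, hα, hα1, C, hC⟩, -, -⟩ := h
  refine ⟨α, C, by exact_mod_cast hα, by exact_mod_cast hα1, C.2, fun x hx y hy => ?_⟩
  have := hC x hx y hy
  rw [edist_nndist, edist_nndist, ← ENNReal.coe_rpow_of_nonneg _ (NNReal.coe_nonneg α), ← ENNReal.coe_mul,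
    ENNReal.coe_le_coe, ← NNReal.coe_le_coe] at this
  simpa [Real.dist_eq, dist_eq_norm] using this

theorem core {N : ℕ} (hN : 0 < N) {Ω : Set (Euc N)} (ho : IsOpen Ω)
    (hb : Bornology.IsBounded Ω) (hΩ : Ω.Nonempty) {f s : Bool → Euc N → ℝ}
    (hf : ∀ i, HypH Ω (f i)) {l l' : Bool → ℝ} (hl' : ∀ i, 0 < l' i) (hl : ∀ i, l' i ≤ l i)
    (s1 : ∀ i, ContDiffOn ℝ 2 (s i) Ω) (s2 : ∀ i, ContinuousOn (s i) (closure Ω))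
    (s3 : ∀ i, ∀ x ∈ Ω, 0 ≤ s i x ∧ s i x < 1) (s4 : ∀ i, ∀ x ∈ frontier Ω, s i x = 0)
    (s5 : ∀ i, ∀ x ∈ Ω, -lap (s i) x = l i * f i x / (1 - s (!i) x) ^ 2) :
    ∃ w : Bool → Euc N → ℝ, (∀ i, ContDiffOn ℝ 2 (w i) Ω) ∧ (∀ i, ContinuousOn (w i) (closure Ω)) ∧
    (∀ i, ∀ x ∈ Ω, 0 ≤ w i x ∧ w i x < 1) ∧ (∀ i, ∀ x ∈ frontier Ω, w i x = 0) ∧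
    (∀ i, ∀ x ∈ Ω, -lap (w i) x = l' i * f i x / (1 - w (!i) x) ^ 2) := by
  obtain ⟨k⟩ := exists_ker N
  have hne : Ωᶜ.Nonempty := by
    have : Nonempty (Fin N) := ⟨⟨0, hN⟩⟩
    rw [nonempty_compl]
    rintro rfl
    exact NormedSpace.unbounded_univ ℝ (Euc N) hb
  choose F hF hF0 hF1 hFf using fun i => ext_cont (hf i)
  set U : Bool → Euc N → ℝ := fun i => Ω.indicator (s i) with hUdef
  have Uc : ∀ i, Continuous (U i) := fun i => continuous_indicator (s4 i) (s2 i)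
  have Ue : ∀ i x, x ∈ Ω → U i x = s i x := fun i x hx => indicator_of_mem hx _
  have Uo : ∀ i x, x ∉ Ω → U i x = 0 := fun i x hx => indicator_of_notMem hx _
  have U0 : ∀ i x, 0 ≤ U i x := by
    intro i x
    by_cases hx : x ∈ Ω
    · rw [Ue i x hx]; exact (s3 i x hx).1
    · rw [Uo i x hx]
  have U1 : ∀ i x, U i x < 1 := by
    intro i x
    by_cases hx : x ∈ Ω
    · rw [Ue i x hx]; exact (s3 i x hx).2
    · rw [Uo i x hx]; exact zero_lt_one
  have hmax : ∀ i, ∃ m < 1, ∀ x, U i x ≤ m := by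
    intro i
    obtain ⟨y, hy, hm⟩ := hb.isCompact_closure.exists_isMaxOn hΩ.closure (Uc i).continuousOn
    refine ⟨U i y, U1 i y, fun x => ?_⟩
    by_cases hx : x ∈ Ω
    · exact hm (subset_closure hx)
    · rw [Uo i x hx]; exact U0 i y
  choose m hm1 hmU using hmax
  obtain ⟨M, hM, hUM⟩ : ∃ M < 1, ∀ i x, U i x ≤ M := by
    refine ⟨max (m true) (m false), max_lt (hm1 _) (hm1 _), fun i x => ?_⟩
    cases i
    · exact (hmU _ x).trans (le_max_right _ _)
    · exact (hmU _ x).trans (le_max_left _ _)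
  have hl0 : ∀ i, 0 ≤ l' i := fun i => (hl' i).le
  have hl00 : ∀ i, 0 ≤ l i := fun i => (hl0 i).trans (hl i)
  have I0 : PInv k Ω F l' U U (rhs F l U) := by
    refine ⟨Uc, Uo, U0, fun _ _ => le_rfl, rhs_cont l hF Uc U1,
      fun i => ⟨_, fun x => rhs_bdd hF0 hF1 hl00 hM (hUM _ x)⟩, fun i x => ?_, fun i j x hx => ?_⟩
    · unfold rhs
      have := hF0 i x
      have := hl i
      gcongr
    · refine k.c2_local ho ((s1 i).congr (Ue i)) (rho_pos j) hx fun y hy => ?_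
      have hyΩ : y ∈ Ω := hx (closedBall_subset_closedBall (by linarith [rho_pos j]) hy)
      have : U i =ᶠ[𝓝 y] s i := by
        filter_upwards [ho.mem_nhds hyΩ] with z hz using Ue i z hz
      rw [lap_congr this, s5 i y hyΩ]
      unfold rhs
      rw [hFf i y (subset_closure hyΩ), Ue _ y hyΩ]
  obtain ⟨w, wm, w0, wU, wrep⟩ := exists_limit hN k ho hb hne hF hF0 hF1 hl0 hM hUM I0
  have woff : ∀ i x, x ∉ Ω → w i x = 0 := fun i x hx =>
    le_antisymm ((wU i x).trans (Uo i x hx).le) (w0 i x)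
  have D : LimD k Ω F l' M w := ⟨ho, hb, hF, hF0, hF1, hl0, hM, wm, woff, w0,
    fun i x => (wU i x).trans (hUM i x), wrep⟩
  have hc2 : ∀ i, ContDiffOn ℝ 2 (w i) Ω := by
    intro i
    obtain ⟨α, Cf, h1, h2, h3, h4⟩ := hyp_holder (hf i)
    refine D.c2 i h1 h2 h3 fun x hx y hy => ?_
    rw [hFf i x (subset_closure hx), hFf i y (subset_closure hy)]
    exact h4 x (subset_closure hx) y (subset_closure hy)
  refine ⟨w, hc2, fun i x hx => ?_, fun i x hx => ⟨w0 i x, (wU i x).trans_lt (U1 i x)⟩,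
    fun i x hx => woff i x ?_, fun i x hx => ?_⟩
  · by_cases hxΩ : x ∈ Ω
    · exact ((hc2 i).continuousOn.continuousAt (ho.mem_nhds hxΩ)).continuousWithinAt
    · apply ContinuousAt.continuousWithinAt
      have h1 := (Uc i).tendsto x
      rw [Uo i x hxΩ] at h1
      unfold ContinuousAt
      rw [woff i x hxΩ]
      exact tendsto_of_tendsto_of_tendsto_of_le_of_le tendsto_const_nhds h1 (w0 i) (wU i)
  · rw [ho.frontier_eq] at hx
    exact hx.2
  · rw [D.eqn hc2 i hx]
    unfold rhs
    rw [hFf i x (subset_closure hx)]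

/-- **Lemma (Λ is downward closed).** If `(λ′,μ′)` is in the positive quadrant with
`λ′ ≤ λ` and `μ′ ≤ μ` for some `(λ,μ) ∈ Λ`, then `(λ′,μ′) ∈ Λ`. -/
theorem statement10 {N : ℕ} (hN : 2 ≤ N) (Ω : Set (Euc N)) (hΩ : IsBddDomain Ω)
    (f g : Euc N → ℝ) (hf : HypH Ω f) (hg : HypH Ω g)
    (lam mu lam' mu' : ℝ) (hlam' : 0 < lam') (hmu' : 0 < mu')
    (h1 : lam' ≤ lam) (h2 : mu' ≤ mu) (hmem : (lam, mu) ∈ LambdaSet Ω f g) :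
    (lam', mu') ∈ LambdaSet Ω f g := by
  obtain ⟨-, -, u, v, S⟩ := hmem
  refine ⟨hlam', hmu', ?_⟩
  obtain ⟨w, w1, w2, w3, w4, w5⟩ := core (by omega) hΩ.1 hΩ.2.1 hΩ.2.2
    (f := fun i => bif i then f else g) (s := fun i => bif i then u else v)
    (l := fun i => bif i then lam else mu) (l' := fun i => bif i then lam' else mu')
    (Bool.rec hg hf) (Bool.rec hmu' hlam') (Bool.rec h2 h1)
    (Bool.rec S.smooth_v S.smooth_u) (Bool.rec S.cont_v S.cont_u) (Bool.rec S.range_v S.range_u)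
    (Bool.rec S.bdry_v S.bdry_u) (Bool.rec S.eq_v S.eq_u)
  exact ⟨w true, w false, w1 true, w1 false, w2 true, w2 false, w3 true, w3 false, w4 true,
    w4 false, w5 true, w5 false⟩
end
end
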